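/- Let n ≥ 1, let 0 < r₁ ≤ r₂ ≤ … ≤ r_n, and let E = {z ∈ ℂ^n : Σ_{i=1}^n |z_i|²/r_i² < 1} be the corresponding open solid ellipsoid in ℝ^{2n} ≅ ℂ^n. Then c_HZ(E, {0}) = π r₁². -/

import Mathlib

open scoped RealInnerProductSpace ENNReal NNReal Topology
open Metric Set

noncomputable section

/-- `ℝ^{2n}` identified with `ℂ^n`, with the standard (real) inner product and
the standard complex structure `J` given by multiplication by `i`. -/
abbrev Esp (n : ℕ) := EuclideanSpace ℂ (Fin n)

variable {n : ℕ}

/-- The Hamiltonian vector field `X_H = J ∇H` of `H : ℝ^{2n} → ℝ`. -/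
def hamVF (H : Esp n → ℝ) (x : Esp n) : Esp n := Complex.I • gradient H x

/-- A nonconstant `T`-periodic orbit of the Hamiltonian flow of `H`:
a nonconstant solution `γ` of `γ' = J∇H(γ)` with `γ (t + T) = γ t`. -/
def IsPeriodicOrbit (H : Esp n → ℝ) (γ : ℝ → Esp n) (T : ℝ) : Prop :=
  0 < T ∧ (∀ t, HasDerivAt γ (hamVF H (γ t)) t) ∧
    (∀ t, γ (t + T) = γ t) ∧ ∃ t₀ t₁, γ t₀ ≠ γ t₁

/-- `H` has a fast (period `≤ 1`) nonconstant periodic orbit. -/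
def HasFastOrbit (H : Esp n → ℝ) : Prop :=
  ∃ γ T, IsPeriodicOrbit H γ T ∧ T ≤ 1

/-- The symplectic action of a `1`-periodic loop `γ` with respect to the
(possibly time-dependent) Hamiltonian `H`:
`A_H(γ) = -(1/2)∫₀¹ ⟨Jγ(t), γ'(t)⟩ dt + ∫₀¹ H(t, γ(t)) dt`. -/
def action (H : ℝ → Esp n → ℝ) (γ : ℝ → Esp n) : ℝ :=
  -(1 / 2) * (∫ t in (0:ℝ)..1, ⟪(Complex.I • γ t : Esp n), deriv γ t⟫) +
    ∫ t in (0:ℝ)..1, H t (γ t)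

/-- The class `𝓗(V, Z)`: smooth functions on `ℝ^{2n}` with compact support
contained in `V`, constant on a neighborhood of `Z`, whose value on `Z` is the
maximum of `H`. -/
def InHclass (V Z : Set (Esp n)) (H : Esp n → ℝ) : Prop :=
  ContDiff ℝ (⊤ : ℕ∞) H ∧ IsCompact (tsupport H) ∧ tsupport H ⊆ V ∧
    (∃ U, IsOpen U ∧ Z ⊆ U ∧ ∃ c : ℝ, ∀ x ∈ U, H x = c) ∧
    ∀ z ∈ Z, ∀ x, H x ≤ H z

/-- The relative Hofer–Zehnder capacity `c_HZ(V, Z)`: the supremum of `max H`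
over all `H ∈ 𝓗(V, Z)` having no fast nonconstant periodic orbit (for `z ∈ Z`,
`H z = max H`). -/
def relCap (V Z : Set (Esp n)) : ℝ≥0∞ :=
  sSup {c | ∃ H, InHclass V Z H ∧ ¬ HasFastOrbit H ∧
    ∃ z ∈ Z, c = ENNReal.ofReal (H z)}

/-! Part 1 -/


section Brouwer
open MeasureTheory Polynomial

/-- `det (1 + t A)` is a polynomial in `t` of degree at most `d`. -/
theorem bw_det_poly {E : Type*} [NormedAddCommGroup E] [NormedSpace ℝ E] [FiniteDimensional ℝ E]
    (A : E →L[ℝ] E) :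
    ∃ p : ℝ[X], p.degree < (Module.finrank ℝ E + 1 : ℕ) ∧
      ∀ t : ℝ, p.eval t = (ContinuousLinearMap.id ℝ E + t • A).det := by
  let b := Module.finBasis ℝ E
  let M := LinearMap.toMatrix b b (A : E →ₗ[ℝ] E)
  refine ⟨Matrix.det ((X : ℝ[X]) • M.map C + (1 : Matrix _ _ ℝ).map C), ?_, ?_⟩
  · have h := Polynomial.natDegree_det_X_add_C_le M 1
    rw [Fintype.card_fin] at h
    refine lt_of_le_of_lt Polynomial.degree_le_natDegree ?_
    exact_mod_cast Nat.lt_succ_of_le h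
  · intro t
    have : (ContinuousLinearMap.id ℝ E + t • A).det = Matrix.det (t • M + 1) := by
      rw [ContinuousLinearMap.det, ← LinearMap.det_toMatrix b]
      congr 1
      have : ((ContinuousLinearMap.id ℝ E + t • A : E →L[ℝ] E) : E →ₗ[ℝ] E)
        = LinearMap.id + t • (A : E →ₗ[ℝ] E) := rfl
      rw [this, map_add, map_smul, LinearMap.toMatrix_id, add_comm]
    rw [this, ← Polynomial.coe_evalRingHom, RingHom.map_det]
    congr 1
    ext i j
    simp [Matrix.map_apply, Matrix.one_apply]
    split_ifs <;> simp [mul_comm]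

theorem bw_det_pos {E : Type*} [NormedAddCommGroup E] [NormedSpace ℝ E] [FiniteDimensional ℝ E]
    (A : E →L[ℝ] E) (t : ℝ) (ht : 0 ≤ t) (h : t * ‖A‖ < 1) :
    0 < (ContinuousLinearMap.id ℝ E + t • A).det := by
  obtain ⟨p, -, hp⟩ := bw_det_poly A
  have hne : ∀ s ∈ Icc 0 t, p.eval s ≠ 0 := by
    intro s hs h0
    rw [hp, ContinuousLinearMap.det] at h0
    obtain ⟨v, hv, hv0⟩ := Submodule.exists_mem_ne_zero_of_ne_bot
      (LinearMap.bot_lt_ker_of_det_eq_zero h0).ne'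
    have hv' : v + s • A v = 0 := by simpa using hv
    have h1 : ‖v‖ = s * ‖A v‖ := by
      have h1 := congrArg norm (eq_neg_of_add_eq_zero_left hv')
      rwa [norm_neg, norm_smul, Real.norm_of_nonneg hs.1] at h1
    have h2 := A.le_opNorm v
    have h3 : 0 < ‖v‖ := norm_pos_iff.2 hv0
    have : s * ‖A‖ ≤ t * ‖A‖ := mul_le_mul_of_nonneg_right hs.2 (norm_nonneg _)
    nlinarith [mul_le_mul_of_nonneg_left h2 hs.1]
  have h0 : p.eval 0 = 1 := by
    rw [hp]; simp [ContinuousLinearMap.det]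
  rw [← hp]
  by_contra hcon
  push Not at hcon
  obtain ⟨s, hs, hs0⟩ := intermediate_value_Icc' ht (p.continuous.continuousOn)
    (show (0:ℝ) ∈ Icc (p.eval t) (p.eval 0) from ⟨hcon, by rw [h0]; norm_num⟩)
  exact hne s hs hs0

theorem bw_no_retract {E : Type*} [NormedAddCommGroup E] [InnerProductSpace ℝ E]
    [FiniteDimensional ℝ E] (f : E → E) (hf : ContDiff ℝ 1 f) (hn : ∀ x, ‖f x‖ = 1)
    (hid : ∀ x, ‖x‖ = 1 → f x = x) : False := by
  borelize E
  let μ : Measure E := Measure.addHaar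
  let g : E → E := fun x => f x - x
  have hg : ContDiff ℝ 1 g := hf.sub contDiff_id
  let A : E → (E →L[ℝ] E) := fun x => fderiv ℝ g x
  have hAc : Continuous A := hg.continuous_fderiv (by norm_num)
  obtain ⟨C, hC⟩ := (isCompact_closedBall (0:E) 1).exists_bound_of_continuousOn hAc.continuousOn
  have hC0 : 0 ≤ C := (norm_nonneg _).trans (hC 0 (by simp))
  set t0 : ℝ := 1 / (2 * (C + 1)) with ht0
  have ht0p : 0 < t0 := by positivity
  have ht0C : t0 * C < 1 / 2 := by
    rw [ht0]; rw [div_mul_eq_mul_div, div_lt_iff₀ (by positivity)]; linarith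
  have ht01 : t0 < 1 := by
    rw [ht0, div_lt_one (by positivity)]; linarith
  have hder : ∀ (t : ℝ) (x : E), HasFDerivAt (fun x => x + t • g x) (ContinuousLinearMap.id ℝ E + t • A x) x := by
    intro t x
    exact (hasFDerivAt_id x).add (((hg.differentiable (by norm_num)) x).hasFDerivAt.const_smul t)
  have hlip : ∀ x ∈ closedBall (0:E) 1, ∀ y ∈ closedBall (0:E) 1, ‖g x - g y‖ ≤ C * ‖x - y‖ := by
    intro x hx y hy
    exact (convex_closedBall (0:E) 1).norm_image_sub_le_of_norm_fderiv_le
      (fun z _ => (hg.differentiable (by norm_num)) z) hC hy hx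
  have key : ∀ t ∈ Icc 0 t0, ∫ x in ball (0:E) 1, (ContinuousLinearMap.id ℝ E + t • A x).det ∂μ
      = (μ (ball (0:E) 1)).toReal := by
    intro t ht
    have htC : t * C < 1 / 2 := lt_of_le_of_lt (mul_le_mul_of_nonneg_right ht.2 hC0) ht0C
    let ft : E → E := fun x => x + t • g x
    have happ : ApproximatesLinearOn ft ((ContinuousLinearEquiv.refl ℝ E : E ≃L[ℝ] E) : E →L[ℝ] E)
        (closedBall (0:E) 1) (1/2) := by
      intro x hx y hy
      have : ft x - ft y - (x - y) = t • (g x - g y) := by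
        simp only [ft, smul_sub]; abel
      change ‖ft x - ft y - (x - y)‖ ≤ _
      rw [this, norm_smul, Real.norm_of_nonneg ht.1]
      have h1 := hlip x hx y hy
      have h2 : (((1/2 : ℝ≥0)) : ℝ) = 1/2 := by norm_num
      rw [h2]
      have := mul_le_mul_of_nonneg_left h1 ht.1
      nlinarith [norm_nonneg (x - y)]
    have hinj : InjOn ft (closedBall (0:E) 1) := by
      intro x hx y hy hxy
      have h1 := happ x hx y hy
      rw [hxy, sub_self, zero_sub, norm_neg] at h1
      change ‖x - y‖ ≤ (((1/2 : ℝ≥0)) : ℝ) * ‖x - y‖ at h1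
      have h2 : (((1/2 : ℝ≥0)) : ℝ) = 1/2 := by norm_num
      rw [h2] at h1
      have : ‖x - y‖ = 0 := by linarith [norm_nonneg (x - y)]
      exact sub_eq_zero.1 (norm_eq_zero.1 this)
    have hftc : Continuous ft := by
      have := hg.continuous; fun_prop
    have hopen : IsOpen (ft '' ball (0:E) 1) := by
      rcases subsingleton_or_nontrivial E with hE | hE
      · exact isOpen_discrete _
      refine (happ.mono_set ball_subset_closedBall).open_image
        (ContinuousLinearEquiv.refl ℝ E).toNonlinearRightInverse isOpen_ball (Or.inr ?_)
      change (1/2 : ℝ≥0) < (‖((ContinuousLinearEquiv.refl ℝ E).symm : E →L[ℝ] E)‖₊)⁻¹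
      have : ‖((ContinuousLinearEquiv.refl ℝ E).symm : E →L[ℝ] E)‖₊ = 1 := by
        have : ((ContinuousLinearEquiv.refl ℝ E).symm : E →L[ℝ] E) = ContinuousLinearMap.id ℝ E := rfl
        rw [this]; ext; simp
      rw [this]
      rw [inv_one]
      exact NNReal.half_lt_self one_ne_zero
    have hmaps : ft '' ball (0:E) 1 ⊆ ball (0:E) 1 := by
      rintro _ ⟨x, hx, rfl⟩
      rw [mem_ball_zero_iff] at hx ⊢
      have : ft x = (1 - t) • x + t • f x := by
        simp only [ft, g, smul_sub, sub_smul, one_smul]; abel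
      rw [this]
      have h1t : 0 < 1 - t := by linarith [ht.2]
      calc ‖(1 - t) • x + t • f x‖ ≤ ‖(1 - t) • x‖ + ‖t • f x‖ := norm_add_le _ _
        _ = (1 - t) * ‖x‖ + t := by
          rw [norm_smul, norm_smul, Real.norm_of_nonneg h1t.le, Real.norm_of_nonneg ht.1, hn, mul_one]
        _ < 1 := by nlinarith
    have himg : ft '' ball (0:E) 1 = ball (0:E) 1 := by
      refine Subset.antisymm hmaps ?_
      refine (convex_ball (0:E) 1).isPreconnected.subset_of_closure_inter_subset hopen ?_ ?_
      · exact ⟨ft 0, hmaps ⟨0, by simp, rfl⟩, ⟨0, by simp, rfl⟩⟩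
      · rintro y ⟨hy1, hy2⟩
        have hcl : closure (ft '' ball (0:E) 1) ⊆ ft '' closedBall (0:E) 1 :=
          closure_minimal (image_mono ball_subset_closedBall)
            ((isCompact_closedBall (0:E) 1).image hftc).isClosed
        obtain ⟨x, hx, rfl⟩ := hcl hy1
        refine ⟨x, ?_, rfl⟩
        rw [mem_closedBall_zero_iff] at hx
        rw [mem_ball_zero_iff]
        refine lt_of_le_of_ne hx fun h => ?_
        have : ft x = x := by simp [ft, g, hid x h]
        rw [this, mem_ball_zero_iff] at hy2
        exact hy2.ne h
    have hcv := lintegral_abs_det_fderiv_eq_addHaar_image μ (measurableSet_ball (x := (0:E)) (ε := 1))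
      (fun x _ => (hder t x).hasFDerivWithinAt) (hinj.mono ball_subset_closedBall)
    have himg' : (fun x => x + t • g x) '' ball (0:E) 1 = ball (0:E) 1 := himg
    rw [himg'] at hcv
    have hpos : ∀ x ∈ ball (0:E) 1, 0 < (ContinuousLinearMap.id ℝ E + t • A x).det := by
      intro x hx
      refine bw_det_pos _ _ ht.1 ?_
      have := mul_le_mul_of_nonneg_left (hC x (ball_subset_closedBall hx)) ht.1
      linarith
    rw [← hcv, integral_eq_lintegral_of_nonneg_ae]
    · congr 1
      refine setLIntegral_congr_fun measurableSet_ball fun x hx => ?_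
      simp only [abs_of_pos (hpos x hx)]
    · exact (ae_restrict_iff' measurableSet_ball).2 (Filter.Eventually.of_forall fun x hx => (hpos x hx).le)
    · refine Continuous.aestronglyMeasurable ?_
      exact ContinuousLinearMap.continuous_det.comp (by fun_prop)
  -- Lagrange interpolation
  let d := Module.finrank ℝ E
  let v : ℕ → ℝ := fun j => t0 * (1 / (j + 1))
  have hvinj : Set.InjOn v (Finset.range (d + 1)) := by
    intro i _ j _ hij
    have : (1 : ℝ) / (i + 1) = 1 / (j + 1) := mul_left_cancel₀ ht0p.ne' hij
    have hi : (0:ℝ) < i + 1 := by positivity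
    have hj : (0:ℝ) < j + 1 := by positivity
    rw [div_eq_div_iff hi.ne' hj.ne'] at this
    have : (i : ℝ) = j := by linarith
    exact_mod_cast this
  have hvmem : ∀ j, v j ∈ Icc 0 t0 := by
    intro j
    have hj : (0:ℝ) < j + 1 := by positivity
    refine ⟨by positivity, ?_⟩
    have : (1 : ℝ) / (j + 1) ≤ 1 := by
      rw [div_le_one hj]; linarith [(Nat.cast_nonneg j : (0:ℝ) ≤ j)]
    calc v j ≤ t0 * 1 := mul_le_mul_of_nonneg_left this ht0p.le
      _ = t0 := mul_one _
  let ℓ : ℕ → ℝ := fun j => (Lagrange.basis (Finset.range (d + 1)) v j).eval 1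
  have hℓ : ∑ j ∈ Finset.range (d + 1), ℓ j = 1 := by
    have := Lagrange.sum_basis hvinj ⟨0, by simp⟩
    have h2 := congrArg (Polynomial.eval (1:ℝ)) this
    rw [Polynomial.eval_finsetSum, Polynomial.eval_one] at h2
    exact h2
  have hexp : ∀ x, (ContinuousLinearMap.id ℝ E + (1:ℝ) • A x).det
      = ∑ j ∈ Finset.range (d + 1), ℓ j * (ContinuousLinearMap.id ℝ E + v j • A x).det := by
    intro x
    obtain ⟨p, hpd, hp⟩ := bw_det_poly (A x)
    have h1 := Lagrange.eq_interpolate hvinj (f := p) (by rw [Finset.card_range]; exact hpd)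
    rw [← hp, h1, Lagrange.interpolate_apply, Polynomial.eval_finsetSum]
    refine Finset.sum_congr rfl fun j _ => ?_
    rw [Polynomial.eval_mul, Polynomial.eval_C, hp, mul_comm]
  have hzero : ∀ x, (ContinuousLinearMap.id ℝ E + (1:ℝ) • A x).det = 0 := by
    intro x
    have hfx : HasFDerivAt f (fderiv ℝ f x) x := ((hf.differentiable (by norm_num)) x).hasFDerivAt
    have hAx : ContinuousLinearMap.id ℝ E + (1:ℝ) • A x = fderiv ℝ f x := by
      have := (hasFDerivAt_id x).add ((hg.differentiable (by norm_num)) x).hasFDerivAt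
      have h2 : (id + g) = f := by funext y; simp [g]
      rw [h2] at this
      rw [one_smul]; exact this.unique hfx
    rw [hAx]
    by_contra hdet
    have hsurj : Function.Surjective (fderiv ℝ f x) := by
      have := (LinearMap.equivOfDetNeZero (fderiv ℝ f x : E →ₗ[ℝ] E) hdet).surjective
      exact this
    obtain ⟨w, hw⟩ := hsurj (f x)
    have h3 : HasFDerivAt (fun y => ⟪f y, f y⟫) _ x := hfx.inner ℝ hfx
    have h4 : (fun y => ⟪f y, f y⟫) = fun _ => (1:ℝ) := by
      funext y; rw [real_inner_self_eq_norm_sq, hn]; norm_num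
    rw [h4] at h3
    have h5 := congrArg (fun L => L w) (h3.unique (hasFDerivAt_const (1:ℝ) x))
    simp [hw, hn] at h5
  have hfin : ∫ x in ball (0:E) 1, (ContinuousLinearMap.id ℝ E + (1:ℝ) • A x).det ∂μ
      = (μ (ball (0:E) 1)).toReal := by
    simp_rw [hexp]
    rw [integral_finsetSum]
    · simp_rw [integral_const_mul]
      rw [Finset.sum_congr rfl fun j _ => by rw [key (v j) (hvmem j)], ← Finset.sum_mul, hℓ, one_mul]
    · intro j _
      refine Integrable.const_mul ?_ _
      have hcont : Continuous fun x => (ContinuousLinearMap.id ℝ E + v j • A x).det :=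
        ContinuousLinearMap.continuous_det.comp (by fun_prop)
      exact (hcont.continuousOn.integrableOn_compact (isCompact_closedBall (0:E) 1)).mono_set
        ball_subset_closedBall
  simp_rw [hzero] at hfin
  simp only [integral_zero] at hfin
  have := ENNReal.toReal_pos (measure_ball_pos μ (0:E) one_pos).ne' measure_ball_lt_top.ne
  linarith

/-- A continuous self-map of a finite-dimensional space that is the identity
outside a bounded set is surjective. -/
theorem bw_surj_inner {E : Type*} [NormedAddCommGroup E] [InnerProductSpace ℝ E]
    [FiniteDimensional ℝ E] (F : E → E) (hF : Continuous F) (R : ℝ)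
    (hid : ∀ x, R ≤ ‖x‖ → F x = x) : Function.Surjective F := by
  intro y
  by_contra hy
  push Not at hy
  let F1 : E → E := fun x => F (x + y) - y
  have hF1 : Continuous F1 := by fun_prop
  have hF1ne : ∀ x, F1 x ≠ 0 := fun x h => hy _ (sub_eq_zero.1 h)
  set R1 : ℝ := |R| + ‖y‖ + 1 with hR1
  have hR1p : 0 < R1 := by positivity
  have hid1 : ∀ x, R1 - 1 ≤ ‖x‖ → F1 x = x := by
    intro x hx
    have : R ≤ ‖x + y‖ := by
      have := norm_sub_le (x + y) y
      rw [add_sub_cancel_right] at this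
      linarith [le_abs_self R]
    simp [F1, hid _ this]
  obtain ⟨G, hG, hGd, hGs⟩ := (hF1.sub continuous_id).exists_contDiff_approx 1
    (ε := fun x => ‖F1 x‖) hF1.norm (fun x => norm_pos_iff.2 (hF1ne x))
  let F2 : E → E := fun x => G x + x
  have hF2 : ContDiff ℝ 1 F2 := hG.add contDiff_id
  have hF2ne : ∀ x, F2 x ≠ 0 := by
    intro x h
    have h1 := hGd x
    have : G x = -x := eq_neg_of_add_eq_zero_left h
    have h2 : -x - (F1 x - x) = - F1 x := by abel
    simp [dist_eq_norm, this, h2] at h1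
  have hid2 : ∀ x, R1 - 1 ≤ ‖x‖ → F2 x = x := by
    intro x hx
    have : G x = 0 := by
      by_contra h
      have := hGs h
      exact this (by simp [hid1 x hx])
    simp [F2, this]
  refine bw_no_retract (fun x => (‖F2 (R1 • x)‖)⁻¹ • F2 (R1 • x)) ?_ ?_ ?_
  · have h1 : ContDiff ℝ 1 fun x => F2 (R1 • x) := hF2.comp (contDiff_const_smul R1)
    have h2 : ∀ x, ‖F2 (R1 • x)‖ ≠ 0 := fun x => norm_ne_zero_iff.2 (hF2ne _)
    exact ((h1.norm ℝ (fun x => hF2ne _)).inv h2).smul h1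
  · intro x
    rw [norm_smul, norm_inv, norm_norm, inv_mul_cancel₀ (norm_ne_zero_iff.2 (hF2ne _))]
  · intro x hx
    have h1 : ‖R1 • x‖ = R1 := by rw [norm_smul, hx, Real.norm_of_nonneg hR1p.le, mul_one]
    have h2 : F2 (R1 • x) = R1 • x := hid2 _ (by rw [h1]; linarith)
    simp only [h2, h1]
    rw [smul_smul, inv_mul_cancel₀ hR1p.ne', one_smul]

end Brouwer

/-! Part 2 -/


section Minimax

/-- Linking / minimax principle in finite dimension, producing almost critical points. -/
theorem mm_minimax {V : Type*} [NormedAddCommGroup V] [InnerProductSpace ℝ V]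
    [FiniteDimensional ℝ V] (U : Submodule ℝ V) (e : V) (he : e ∈ Uᗮ) (hen : ‖e‖ = 1)
    (Φ : V → ℝ) (hΦ : Continuous Φ) (G : V → V) (hG : Continuous G) (L : ℝ) (hL : 0 < L)
    (hdesc : ∀ x v, Φ (x + v) ≤ Φ x + ⟪G x, v⟫ + L / 2 * ‖v‖ ^ 2)
    (hU : ∀ y ∈ U, Φ y ≤ 0) (τ : ℝ)
    (hτ : ∀ y ∈ U, ∀ s : ℝ, 0 ≤ s → τ ≤ ‖y + s • e‖ → Φ (y + s • e) ≤ 0)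
    (α β : ℝ) (hα : 0 < α) (hβ : 0 < β) (hΓ : ∀ x ∈ Uᗮ, ‖x‖ = α → β ≤ Φ x)
    (δ : ℝ) (hδ : 0 < δ) : ∃ x, β ≤ Φ x ∧ ‖G x‖ < δ := by
  by_contra hcon
  push Not at hcon
  let χ : V → ℝ := fun x => min 1 (max (Φ x / β) 0)
  have hχ : Continuous χ := by fun_prop
  have hχ0 : ∀ x, 0 ≤ χ x := fun x => le_min zero_le_one (le_max_right _ _)
  have hχ1 : ∀ x, χ x ≤ 1 := fun x => min_le_left _ _
  let S : V → V := fun x => x + (-(χ x / L)) • G x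
  have hS : Continuous S := by fun_prop
  have hSΦ : ∀ x, Φ (S x) ≤ Φ x - χ x / (2 * L) * ‖G x‖ ^ 2 := by
    intro x
    have h := hdesc x ((-(χ x / L)) • G x)
    rw [inner_smul_right, real_inner_self_eq_norm_sq, norm_smul, mul_pow, Real.norm_eq_abs, sq_abs] at h
    have h2 : -(χ x / L) * ‖G x‖ ^ 2 + L / 2 * ((-(χ x / L)) ^ 2 * ‖G x‖ ^ 2)
        = - (χ x / (2 * L) * ‖G x‖ ^ 2) - χ x * (1 - χ x) / (2 * L) * ‖G x‖ ^ 2 := by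
      field_simp; ring
    have h3 : 0 ≤ χ x * (1 - χ x) / (2 * L) * ‖G x‖ ^ 2 := by
      have := hχ0 x
      have : 0 ≤ 1 - χ x := by linarith [hχ1 x]
      positivity
    change Φ (x + _) ≤ _
    linarith
  have hSfix : ∀ x, Φ x ≤ 0 → S x = x := by
    intro x hx
    have : χ x = 0 := by
      have : Φ x / β ≤ 0 := div_nonpos_of_nonpos_of_nonneg hx hβ.le
      simp [χ, this]
    simp [S, this]
  have hSle : ∀ x, Φ (S x) ≤ Φ x := by
    intro x
    have := hχ0 x
    have : 0 ≤ χ x / (2 * L) * ‖G x‖ ^ 2 := by positivity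
    linarith [hSΦ x]
  set c : ℝ := δ ^ 2 / (2 * L) with hc
  have hcp : 0 < c := by positivity
  have hSdrop : ∀ x, β ≤ Φ x → Φ (S x) ≤ Φ x - c := by
    intro x hx
    have h1 : χ x = 1 := by
      have : 1 ≤ Φ x / β := by rwa [le_div_iff₀ hβ, one_mul]
      simp [χ, this]
    have h2 := hSΦ x
    rw [h1] at h2
    have h3 : δ ^ 2 ≤ ‖G x‖ ^ 2 := pow_le_pow_left₀ hδ.le (hcon x hx) 2
    have : c ≤ 1 / (2 * L) * ‖G x‖ ^ 2 := by
      rw [hc, div_eq_mul_one_div, mul_comm]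
      exact mul_le_mul_of_nonneg_left h3 (by positivity)
    linarith
  -- iteration
  have hiter : ∀ (k : ℕ) x, Φ (S^[k] x) < β ∨ Φ (S^[k] x) ≤ Φ x - k * c := by
    intro k x
    induction k with
    | zero => right; simp
    | succ k ih =>
      rw [Function.iterate_succ_apply']
      rcases lt_or_ge (Φ (S^[k] x)) β with h | h
      · exact Or.inl (lt_of_le_of_lt (hSle _) h)
      · right
        rcases ih with ih | ih
        · exact absurd ih (not_lt.2 h)
        · have := hSdrop _ h
          push_cast
          linarith
  have hfix : ∀ (k : ℕ) x, Φ x ≤ 0 → S^[k] x = x := fun k x hx =>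
    Function.iterate_fixed (hSfix x hx) k
  obtain ⟨M, hM⟩ := (isCompact_closedBall (0:V) |τ|).bddAbove_image hΦ.continuousOn
  obtain ⟨k, hk⟩ := exists_nat_gt ((M - β) / c)
  have hk' : M - k * c < β := by
    rw [div_lt_iff₀ hcp] at hk; linarith
  let h : V → V := S^[k]
  have hh : Continuous h := hS.iterate k
  let W := WithLp 2 (U × ℝ)
  let ι : W → V := fun w => (w.fst : V) + (max w.snd 0) • e
  have hι : Continuous ι := by
    have h1 : Continuous fun w : W => w.fst := by fun_prop
    have h2 : Continuous fun w : W => w.snd := by fun_prop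
    exact (continuous_subtype_val.comp h1).add ((h2.max continuous_const).smul continuous_const)
  let F : W → W := fun w => w + WithLp.toLp 2
    (U.orthogonalProjectionOnto (h (ι w)) - w.fst, ‖Uᗮ.orthogonalProjectionOnto (h (ι w))‖ - max w.snd 0)
  have hFc : Continuous F := by
    refine continuous_id.add ((WithLp.prod_continuous_toLp 2 U ℝ).comp (Continuous.prodMk ?_ ?_))
    · exact (U.orthogonalProjectionOnto.continuous.comp (hh.comp hι)).sub (by fun_prop)
    · exact (Uᗮ.orthogonalProjectionOnto.continuous.comp (hh.comp hι)).norm.sub (by fun_prop)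
  have hproj1 : ∀ w : W, U.orthogonalProjectionOnto (ι w) = w.fst := by
    intro w
    have h1 : U.orthogonalProjectionOnto e = 0 :=
      Submodule.orthogonalProjectionOnto_eq_zero_iff.2 he
    simp [ι, map_add, map_smul, h1]
  have hproj2 : ∀ w : W, ‖Uᗮ.orthogonalProjectionOnto (ι w)‖ = max w.snd 0 := by
    intro w
    have h1 : Uᗮ.orthogonalProjectionOnto (w.fst : V) = 0 :=
      Submodule.orthogonalProjectionOnto_eq_zero_iff.2
        (Submodule.le_orthogonal_orthogonal U w.fst.2)
    have h2 : Uᗮ.orthogonalProjectionOnto e = ⟨e, he⟩ :=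
      Submodule.orthogonalProjectionOnto_mem_subspace_eq_self (⟨e, he⟩ : Uᗮ)
    have : ‖(⟨e, he⟩ : Uᗮ)‖ = 1 := hen
    simp only [ι, map_add, map_smul, h1, h2, zero_add, norm_smul, this, mul_one]
    rw [Real.norm_of_nonneg (le_max_right _ _)]
  have hFid : ∀ w : W, Φ (ι w) ≤ 0 → F w = w := by
    intro w hw
    have h1 : h (ι w) = ι w := hfix k _ hw
    simp only [F, h1, hproj1, hproj2, sub_self]
    exact add_zero w
  have hιs : ∀ w : W, w.snd ≤ 0 → Φ (ι w) ≤ 0 := by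
    intro w hw
    have : ι w = w.fst := by simp [ι, max_eq_right hw]
    rw [this]
    exact hU _ w.fst.2
  have hιn : ∀ w : W, 0 ≤ w.snd → ‖ι w‖ = ‖w‖ := by
    intro w hw
    have h0 : ⟪(w.fst : V), w.snd • e⟫ = 0 := by
      rw [inner_smul_right, he _ w.fst.2, mul_zero]
    have h1 : ‖ι w‖ ^ 2 = ‖w‖ ^ 2 := by
      rw [WithLp.prod_norm_sq_eq_of_L2]
      simp only [ι, max_eq_left hw]
      rw [norm_add_sq_real, h0, norm_smul, hen]
      simp
    exact (sq_eq_sq₀ (norm_nonneg _) (norm_nonneg _)).1 h1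
  have hFid' : ∀ w : W, τ ≤ ‖w‖ → F w = w := by
    intro w hw
    apply hFid
    rcases le_total w.snd 0 with hs | hs
    · exact hιs w hs
    · have h1 := hιn w hs
      have := hτ _ w.fst.2 w.snd hs
      simp only [ι, max_eq_left hs] at h1 ⊢
      exact this (by rw [h1]; exact hw)
  obtain ⟨w, hw⟩ := bw_surj_inner F hFc τ hFid' (WithLp.toLp 2 ((0 : U), α))
  have hwΦ : 0 < Φ (ι w) := by
    by_contra hc
    have h1 := hFid w (not_lt.1 hc)
    have h2 : w = WithLp.toLp 2 ((0 : U), α) := h1.symm.trans hw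
    have h8 : w.fst = 0 := congrArg WithLp.fst h2
    have h9 : w.snd = α := congrArg WithLp.snd h2
    have h3 : ι w = α • e := by simp [ι, h8, h9, max_eq_left hα.le]
    have h4 : β ≤ Φ (ι w) := by
      rw [h3]
      refine hΓ _ (Uᗮ.smul_mem _ he) ?_
      rw [norm_smul, hen, mul_one, Real.norm_of_nonneg hα.le]
    linarith
  have hwpos : 0 < w.snd ∧ ‖w‖ < τ := by
    have h1 : 0 < w.snd := by
      by_contra hc
      exact absurd hwΦ (not_lt.2 (hιs w (not_lt.1 hc)))
    refine ⟨h1, ?_⟩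
    by_contra hc
    have h2 := hιn w h1.le
    have := hτ _ w.fst.2 w.snd h1.le
    simp only [ι, max_eq_left h1.le] at h2 hwΦ
    exact absurd hwΦ (not_lt.2 (this (by rw [h2]; exact not_lt.1 hc)))
  have hF1 : U.orthogonalProjectionOnto (h (ι w)) = 0 := by
    have h5 : w.fst + (U.orthogonalProjectionOnto (h (ι w)) - w.fst) = 0 := congrArg WithLp.fst hw
    rw [← h5]; abel
  have hF2 : ‖Uᗮ.orthogonalProjectionOnto (h (ι w))‖ = α := by
    have h5 : w.snd + (‖Uᗮ.orthogonalProjectionOnto (h (ι w))‖ - max w.snd 0) = α :=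
      congrArg WithLp.snd hw
    rw [max_eq_left hwpos.1.le] at h5
    linarith
  have h10 : h (ι w) ∈ Uᗮ := Submodule.orthogonalProjectionOnto_eq_zero_iff.1 hF1
  have h11 : Uᗮ.orthogonalProjectionOnto (h (ι w)) = ⟨h (ι w), h10⟩ :=
    Submodule.orthogonalProjectionOnto_mem_subspace_eq_self (⟨h (ι w), h10⟩ : Uᗮ)
  rw [h11] at hF2
  have h12 := hΓ _ h10 hF2
  have h13 : ‖ι w‖ < τ := by rw [hιn w hwpos.1.le]; exact hwpos.2
  have h14 : Φ (ι w) ≤ M := hM ⟨ι w, by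
    rw [mem_closedBall_zero_iff]; exact h13.le.trans (le_abs_self τ), rfl⟩
  rcases hiter k (ι w) with h15 | h15
  · exact absurd h12 (not_le.2 h15)
  · have : Φ (h (ι w)) ≤ Φ (ι w) - k * c := h15
    linarith

end Minimax

/-! Part 3 -/



section Galerkin
open MeasureTheory AddCircle


theorem ga_inner_smul (z : ℂ) (x y : Esp n) :
    ⟪x, z • y⟫ = ⟪(starRingEnd ℂ z) • x, y⟫ := by
  simp only [PiLp.inner_apply, PiLp.smul_apply, Complex.inner, smul_eq_mul]
  refine Finset.sum_congr rfl fun i _ => ?_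
  congr 1
  simp only [map_mul, Complex.conj_conj]; ring

theorem ga_integrable {E : Type*} [NormedAddCommGroup E] {f : UnitAddCircle → E}
    (hf : Continuous f) : Integrable f (haarAddCircle : Measure UnitAddCircle) := by
  borelize E
  exact hf.integrable_of_hasCompactSupport (HasCompactSupport.of_compactSpace f)

theorem ga_norm_fourier (k : ℤ) (t : UnitAddCircle) : ‖fourier k t‖ = 1 := by
  rw [fourier_apply]; exact Circle.norm_coe _

theorem ga_integral_fourier (k : ℤ) : ∫ t, fourier k t ∂(haarAddCircle : Measure UnitAddCircle) = if k = 0 then 1 else 0 := by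
  have h := congrFun (fourierCoeff_fourier (T := 1) k) 0
  simp only [fourierCoeff, neg_zero, fourier_zero, one_smul] at h
  rw [h, Pi.single_apply]
  simp only [eq_comm]

theorem ga_conj_fourier (k : ℤ) (t : UnitAddCircle) :
    (starRingEnd ℂ) (fourier k t) = fourier (-k) t := fourier_neg.symm

/-- The Galerkin space: finitely many Fourier modes. -/
abbrev GV (S : Finset ℤ) (n : ℕ) := PiLp 2 (fun _ : S => Esp n)

def gev {S : Finset ℤ} (x : GV S n) (t : UnitAddCircle) : Esp n :=
  ∑ k : S, fourier (k : ℤ) t • x k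

theorem gev_cont2 {S : Finset ℤ} :
    Continuous fun p : GV S n × UnitAddCircle => gev p.1 p.2 := by
  unfold gev
  fun_prop

theorem gev_cont {S : Finset ℤ} (x : GV S n) : Continuous (gev x) := by
  unfold gev
  fun_prop

theorem gev_add {S : Finset ℤ} (x y : GV S n) (t : UnitAddCircle) :
    gev (x + y) t = gev x t + gev y t := by
  simp [gev, smul_add, Finset.sum_add_distrib]

/-- Integrating against a Galerkin loop. -/
theorem ga_pair {S : Finset ℤ} (f : UnitAddCircle → Esp n) (hf : Continuous f) (y : GV S n) :
    ∫ t, ⟪f t, gev y t⟫ ∂(haarAddCircle : Measure UnitAddCircle) = ∑ k : S, ⟪fourierCoeff f k, y k⟫ := by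
  simp only [gev, inner_sum]
  rw [integral_finsetSum _ (fun k _ => ga_integrable (by fun_prop))]
  refine Finset.sum_congr rfl fun k _ => ?_
  simp only [ga_inner_smul, ga_conj_fourier, fourierCoeff]
  rw [real_inner_comm, ← integral_inner (ga_integrable (by fun_prop))]
  exact integral_congr_ae (Filter.Eventually.of_forall fun t => real_inner_comm _ _)

theorem ga_coeff {S : Finset ℤ} (x : GV S n) (k : ℤ) :
    fourierCoeff (gev x) k = if h : k ∈ S then x ⟨k, h⟩ else 0 := by
  simp only [gev, fourierCoeff, Finset.smul_sum, smul_smul, ← fourier_add]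
  rw [integral_finsetSum _ (fun k _ => ga_integrable (by fun_prop))]
  simp only [integral_smul_const, ga_integral_fourier]
  split_ifs with h
  · rw [Finset.sum_eq_single ⟨k, h⟩]
    · simp
    · intro b _ hb
      rw [if_neg, zero_smul]
      intro h0; apply hb; ext; change (b : ℤ) = k; omega
    · simp
  · refine Finset.sum_eq_zero fun b _ => ?_
    rw [if_neg, zero_smul]
    intro h0
    have : (b : ℤ) = k := by omega
    exact h (this ▸ b.2)

theorem ga_coeff_mem {S : Finset ℤ} (x : GV S n) (k : S) :
    fourierCoeff (gev x) k = x k := by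
  rw [ga_coeff, dif_pos k.2]

theorem ga_parseval {S : Finset ℤ} (x : GV S n) :
    ∫ t, ‖gev x t‖ ^ 2 ∂(haarAddCircle : Measure UnitAddCircle) = ∑ k : S, ‖x k‖ ^ 2 := by
  have := ga_pair (gev x) (gev_cont x) x
  simpa only [ga_coeff_mem, real_inner_self_eq_norm_sq] using this

theorem ga_normsq {S : Finset ℤ} (x : GV S n) : ‖x‖ ^ 2 = ∑ k : S, ‖x k‖ ^ 2 :=
  PiLp.norm_sq_eq_of_L2 _ x

theorem ga_pair_W {S : Finset ℤ} (W : Esp n →L[ℂ] Esp n) (x : GV S n) :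
    ∫ t, ⟪W (gev x t), gev x t⟫ ∂(haarAddCircle : Measure UnitAddCircle) = ∑ k : S, ⟪W (x k), x k⟫ := by
  let y : GV S n := WithLp.toLp 2 fun k => W (x k)
  have h : ∀ t, W (gev x t) = gev y t := by
    intro t; simp [gev, y, map_sum]
  simp only [h]
  rw [ga_pair _ (gev_cont y)]
  simp only [ga_coeff_mem]
  rfl

end Galerkin

/-! Part 4 -/


section GalerkinB
open MeasureTheory AddCircle


/-- Standing assumptions on the asymptotically quadratic Hamiltonian. -/
structure GHyp (K : Esp n → ℝ) (U : Esp n → Esp n) (W : Esp n →L[ℂ] Esp n) (e0 : Esp n)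
    (C δ A B L c w0 : ℝ) : Prop where
  Kc : Continuous K
  Uc : Continuous U
  K0 : ∀ y, 0 ≤ K y
  δ0 : 0 < δ
  Kδ : ∀ y, ‖y‖ < δ → K y = 0
  C0 : 0 ≤ C
  KC : ∀ y, K y ≤ C * ‖y‖ ^ 2
  KA : ∀ y, ⟪W y, y⟫ - A ≤ K y
  w00 : 0 < w0
  Ww : ∀ y, w0 * ‖y‖ ^ 2 ≤ ⟪W y, y⟫
  e01 : ‖e0‖ = 1
  We0 : Real.pi < ⟪W e0, e0⟫
  L0 : 0 < L
  sec : ∀ y v, K y + ⟪U y, v⟫ - L / 2 * ‖v‖ ^ 2 ≤ K (y + v)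
  UB : ∀ y, ‖U y - (2 : ℂ) • W y‖ ≤ B
  c0 : 0 < c
  res : ∀ (k : ℤ) (y : Esp n), c * ‖y‖ ≤ ‖((2 * Real.pi * k : ℝ) : ℂ) • y - (2 : ℂ) • W y‖

def gPhi (K : Esp n → ℝ) {S : Finset ℤ} (x : GV S n) : ℝ :=
  Real.pi * ∑ k : S, (k : ℝ) * ‖x k‖ ^ 2 - ∫ t, K (gev x t) ∂(haarAddCircle : Measure UnitAddCircle)

def gG (U : Esp n → Esp n) {S : Finset ℤ} (x : GV S n) : GV S n :=
  WithLp.toLp 2 fun k => ((2 * Real.pi * (k : ℤ) : ℝ)) • x k - fourierCoeff (fun t => U (gev x t)) k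

variable {K : Esp n → ℝ} {U : Esp n → Esp n} {W : Esp n →L[ℂ] Esp n} {e0 : Esp n}
    {C δ A B L c w0 : ℝ}

theorem ga_param {E Y : Type*} [NormedAddCommGroup E] [NormedSpace ℝ E] [TopologicalSpace Y]
    [FirstCountableTopology Y] [LocallyCompactSpace Y] {f : Y → UnitAddCircle → E}
    (hf : Continuous (Function.uncurry f)) : Continuous fun y => ∫ t, f y t ∂(haarAddCircle : Measure UnitAddCircle) := by
  have := continuous_parametric_integral_of_continuous (μ := (haarAddCircle : Measure UnitAddCircle)) hf
    (isCompact_univ (X := UnitAddCircle))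
  simpa using this

theorem gPhi_cont (h : Continuous K) {S : Finset ℤ} : Continuous (gPhi K (S := S)) := by
  unfold gPhi
  refine Continuous.sub (by fun_prop) ?_
  exact ga_param (h.comp gev_cont2)

theorem gG_cont (h : Continuous U) {S : Finset ℤ} : Continuous (gG U (S := S)) := by
  unfold gG
  refine (PiLp.continuous_toLp 2 _).comp (continuous_pi fun k => Continuous.sub (by fun_prop) ?_)
  unfold fourierCoeff
  refine ga_param ?_
  exact ((map_continuous (fourier (-(k:ℤ)))).comp continuous_snd).smul (h.comp gev_cont2)

theorem gPhi_desc (h : GHyp K U W e0 C δ A B L c w0) {S : Finset ℤ} (N : ℝ)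
    (hN : ∀ k ∈ S, (k : ℝ) ≤ N) (x v : GV S n) :
    gPhi K (x + v) ≤ gPhi K x + ⟪gG U x, v⟫ + (2 * Real.pi * N + L) / 2 * ‖v‖ ^ 2 := by
  have h1 : ∫ t, (K (gev x t) + ⟪U (gev x t), gev v t⟫ - L / 2 * ‖gev v t‖ ^ 2) ∂(haarAddCircle : Measure UnitAddCircle)
      ≤ ∫ t, K (gev (x + v) t) ∂(haarAddCircle : Measure UnitAddCircle) := by
    have := gev_cont x
    have := gev_cont v
    have := h.Kc
    have := h.Uc
    refine integral_mono (ga_integrable (by fun_prop))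
      (ga_integrable (h.Kc.comp (gev_cont _))) fun t => ?_
    simp only [gev_add]
    exact h.sec _ _
  have c1 : Continuous fun t => K (gev x t) := h.Kc.comp (gev_cont x)
  have c2 : Continuous fun t => U (gev x t) := h.Uc.comp (gev_cont x)
  have c3 := gev_cont v
  have c4 : Continuous fun t => ⟪U (gev x t), gev v t⟫ := c2.inner c3
  have c6 : Continuous fun t => K (gev x t) + ⟪U (gev x t), gev v t⟫ := c1.add c4
  have c5 : Continuous fun t => L / 2 * ‖gev v t‖ ^ 2 := by fun_prop
  rw [integral_sub (ga_integrable c6) (ga_integrable c5),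
    integral_add (ga_integrable c1) (ga_integrable c4),
    integral_const_mul, ga_parseval, ga_pair _ c2] at h1
  have h2 : ⟪gG U x, v⟫ = ∑ k : S, (2 * Real.pi * (k : ℝ)) * ⟪x k, v k⟫
      - ∑ k : S, ⟪fourierCoeff (fun t => U (gev x t)) k, v k⟫ := by
    rw [PiLp.inner_apply, ← Finset.sum_sub_distrib]
    refine Finset.sum_congr rfl fun k _ => ?_
    simp only [gG, inner_sub_left, real_inner_smul_left]
  have h3 : ∑ k : S, (k : ℝ) * ‖(x + v) k‖ ^ 2 ≤ ∑ k : S, (k : ℝ) * ‖x k‖ ^ 2 +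
      ∑ k : S, 2 * (k : ℝ) * ⟪x k, v k⟫ + N * ∑ k : S, ‖v k‖ ^ 2 := by
    rw [Finset.mul_sum, ← Finset.sum_add_distrib, ← Finset.sum_add_distrib]
    refine Finset.sum_le_sum fun k _ => ?_
    rw [PiLp.add_apply, norm_add_sq_real]
    have := mul_le_mul_of_nonneg_right (hN k k.2) (sq_nonneg ‖v k‖)
    linarith
  have h4 := mul_le_mul_of_nonneg_left h3 Real.pi_pos.le
  have h5 : ∑ k : S, (2 * Real.pi * (k : ℝ)) * ⟪x k, v k⟫
      = Real.pi * ∑ k : S, 2 * (k : ℝ) * ⟪x k, v k⟫ := by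
    rw [Finset.mul_sum]; exact Finset.sum_congr rfl fun k _ => by ring
  rw [h2, ga_normsq, gPhi, gPhi, h5]
  linarith

/-- The nonpositive modes. -/
def gNeg (S : Finset ℤ) (n : ℕ) : Submodule ℝ (GV S n) where
  carrier := {x | ∀ k : S, 1 ≤ (k : ℤ) → x k = 0}
  add_mem' := by
    intro a b ha hb k hk
    simp [ha k hk, hb k hk]
  zero_mem' := by intro k _; rfl
  smul_mem' := by
    intro c x hx k hk
    simp [hx k hk]

theorem gNeg_orth {S : Finset ℤ} {x : GV S n} (hx : x ∈ (gNeg S n)ᗮ) (k : S)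
    (hk : (k : ℤ) ≤ 0) : x k = 0 := by
  classical
  let y : GV S n := PiLp.single 2 k (x k)
  have hy : y ∈ gNeg S n := by
    intro j hj
    have : j ≠ k := by rintro rfl; omega
    simp [y, this]
  have h := hx y hy
  rw [PiLp.inner_apply, Finset.sum_eq_single k] at h
  · simpa [y] using h
  · intro b _ hb; simp [y, hb]
  · simp

theorem gPhi_neg (h : GHyp K U W e0 C δ A B L c w0) {S : Finset ℤ} (x : GV S n)
    (hx : x ∈ gNeg S n) : gPhi K x ≤ 0 := by
  have h1 : 0 ≤ ∫ t, K (gev x t) ∂(haarAddCircle : Measure UnitAddCircle) := integral_nonneg fun t => h.K0 _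
  have h2 : ∑ k : S, (k : ℝ) * ‖x k‖ ^ 2 ≤ 0 := by
    refine Finset.sum_nonpos fun k _ => ?_
    rcases le_or_gt 1 (k : ℤ) with hk | hk
    · simp [hx k hk]
    · have : ((k : ℤ) : ℝ) ≤ 0 := by exact_mod_cast (by omega : (k : ℤ) ≤ 0)
      exact mul_nonpos_of_nonpos_of_nonneg this (sq_nonneg _)
  have := mul_nonpos_of_nonneg_of_nonpos Real.pi_pos.le h2
  rw [gPhi]; linarith

def gE {S : Finset ℤ} (h1 : (1 : ℤ) ∈ S) (e0 : Esp n) : GV S n :=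
  PiLp.single 2 (⟨1, h1⟩ : S) e0

theorem gE_orth {S : Finset ℤ} (h1 : (1 : ℤ) ∈ S) (e0 : Esp n) :
    gE h1 e0 ∈ (gNeg S n)ᗮ := by
  intro y hy
  rw [PiLp.inner_apply, Finset.sum_eq_single (⟨1, h1⟩ : S)]
  · rw [hy _ le_rfl, inner_zero_left]
  · intro b _ hb; simp [gE, hb]
  · simp

theorem gPhi_link (h : GHyp K U W e0 C δ A B L c w0) {S : Finset ℤ} (h1 : (1 : ℤ) ∈ S) :
    ∃ τ : ℝ, ∀ y ∈ gNeg S n, ∀ s : ℝ, 0 ≤ s → τ ≤ ‖y + s • gE h1 e0‖ →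
      gPhi K (y + s • gE h1 e0) ≤ 0 := by
  set m := min w0 (⟪W e0, e0⟫ - Real.pi) with hm
  have hm0 : 0 < m := lt_min h.w00 (by linarith [h.We0])
  refine ⟨max 1 (A / m), fun y hy s hs hτ => ?_⟩
  set x := y + s • gE h1 e0 with hx
  have hK : ∑ k : S, ⟪W (x k), x k⟫ - A ≤ ∫ t, K (gev x t) ∂(haarAddCircle : Measure UnitAddCircle) := by
    have c1 := gev_cont x
    have := h.Kc
    have h3 : ∫ t, (⟪W (gev x t), gev x t⟫ - A) ∂(haarAddCircle : Measure UnitAddCircle) ≤ ∫ t, K (gev x t) ∂(haarAddCircle : Measure UnitAddCircle) :=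
      integral_mono (ga_integrable (by fun_prop)) (ga_integrable (by fun_prop)) fun t => h.KA _
    rw [integral_sub (ga_integrable (by fun_prop)) (ga_integrable (by fun_prop)), ga_pair_W] at h3
    simpa using h3
  have hterm : ∀ k : S, Real.pi * ((k : ℝ) * ‖x k‖ ^ 2) - ⟪W (x k), x k⟫ ≤ - (m * ‖x k‖ ^ 2) := by
    intro k
    have hq := sq_nonneg ‖x k‖
    have hw := h.Ww (x k)
    have hm1 : m * ‖x k‖ ^ 2 ≤ w0 * ‖x k‖ ^ 2 := mul_le_mul_of_nonneg_right (min_le_left _ _) hq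
    rcases le_or_gt (k : ℤ) 0 with hk | hk
    · have hk' : ((k : ℤ) : ℝ) ≤ 0 := by exact_mod_cast hk
      have : Real.pi * ((k : ℝ) * ‖x k‖ ^ 2) ≤ 0 :=
        mul_nonpos_of_nonneg_of_nonpos Real.pi_pos.le (mul_nonpos_of_nonpos_of_nonneg hk' hq)
      linarith
    · by_cases hk1 : (k : ℤ) = 1
      · have hk2 : k = ⟨1, h1⟩ := Subtype.ext hk1
        have hxk : x k = s • e0 := by
          subst hk2
          simp [hx, hy ⟨1, h1⟩ (le_refl (1:ℤ)), gE]
        have hWs : W (s • e0) = s • W e0 := (W.restrictScalars ℝ).map_smul s e0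
        rw [hxk, hk1, hWs, real_inner_smul_left, real_inner_smul_right, norm_smul, h.e01]
        have : m ≤ ⟪W e0, e0⟫ - Real.pi := min_le_right _ _
        have := mul_le_mul_of_nonneg_left this (sq_nonneg s)
        simp only [Real.norm_eq_abs, mul_one, sq_abs, Int.cast_one]
        linarith
      · have hne : k ≠ ⟨1, h1⟩ := fun hh => hk1 (congrArg Subtype.val hh)
        have hxk : x k = 0 := by
          simp [hx, hy k (by omega), gE, hne]
        simp [hxk]
  have hsum := Finset.sum_le_sum fun k (_ : k ∈ (Finset.univ : Finset S)) => hterm k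
  rw [Finset.sum_sub_distrib, ← Finset.mul_sum, Finset.sum_neg_distrib, ← Finset.mul_sum,
    ← ga_normsq] at hsum
  have hx2 : A ≤ m * ‖x‖ ^ 2 := by
    have h5 : 1 ≤ ‖x‖ := (le_max_left _ _).trans hτ
    have h6 : A / m ≤ ‖x‖ := (le_max_right _ _).trans hτ
    have h7 : A / m ≤ ‖x‖ ^ 2 := by nlinarith
    rwa [div_le_iff₀' hm0] at h7
  rw [gPhi]
  linarith

theorem gPhi_gamma (h : GHyp K U W e0 C δ A B L c w0) :
    ∃ α : ℝ, 0 < α ∧ ∀ (S : Finset ℤ) (x : GV S n), x ∈ (gNeg S n)ᗮ → ‖x‖ = α →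
      Real.pi * α ^ 2 ≤ gPhi K x := by
  obtain ⟨M, hM⟩ := exists_nat_gt (4 * C / Real.pi)
  rw [div_lt_iff₀ Real.pi_pos] at hM
  have hδ := h.δ0
  refine ⟨δ / (2 * (M + 1)), by positivity, fun S x hx hα => ?_⟩
  set α := δ / (2 * (M + 1)) with hαd
  let lo : GV S n := WithLp.toLp 2 fun k => if (k : ℤ) ≤ M then x k else 0
  let hi : GV S n := WithLp.toLp 2 fun k => if (k : ℤ) ≤ M then 0 else x k
  have hsum : lo + hi = x := by
    ext1 k
    by_cases hk : (k : ℤ) ≤ M <;> simp [lo, hi, hk]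
  have hlo : ∀ t, ‖gev lo t‖ ≤ δ / 2 := by
    intro t
    have hxk : ∀ k : S, ‖x k‖ ≤ α := fun k => hα ▸ PiLp.norm_apply_le x k
    have h1 : ‖gev lo t‖ ≤ ∑ k : S, ‖lo k‖ := by
      refine (norm_sum_le _ _).trans (Finset.sum_le_sum fun k _ => ?_)
      rw [norm_smul, ga_norm_fourier, one_mul]
    have h2 : ∑ k : S, ‖lo k‖ ≤ ∑ k : S, if (k : ℤ) ∈ Finset.Icc (1:ℤ) M then α else 0 := by
      refine Finset.sum_le_sum fun k _ => ?_
      have hlk : lo k = if (k : ℤ) ≤ M then x k else 0 := rfl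
      have hα0 : 0 ≤ α := hα ▸ norm_nonneg x
      rw [hlk]
      by_cases hk : (k : ℤ) ≤ M
      · rw [if_pos hk]
        by_cases hk1 : 1 ≤ (k : ℤ)
        · rw [if_pos (Finset.mem_Icc.2 ⟨hk1, hk⟩)]; exact hxk k
        · rw [gNeg_orth hx k (by omega), norm_zero]; split_ifs <;> simp [hα0]
      · rw [if_neg hk, norm_zero]; split_ifs <;> simp [hα0]
    have h3 : (∑ k : S, if (k : ℤ) ∈ Finset.Icc (1:ℤ) M then α else 0) ≤ M * α := by
      have hα0 : 0 ≤ α := hα ▸ norm_nonneg x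
      rw [Finset.sum_coe_sort S (fun k => if k ∈ Finset.Icc (1:ℤ) M then α else 0),
        ← Finset.sum_filter, Finset.sum_const, nsmul_eq_mul]
      refine mul_le_mul_of_nonneg_right ?_ hα0
      have : (S.filter (· ∈ Finset.Icc (1:ℤ) M)).card ≤ (Finset.Icc (1:ℤ) M).card :=
        Finset.card_le_card fun k hk => (Finset.mem_filter.1 hk).2
      have h5 : (Finset.Icc (1:ℤ) M).card = M := by simp
      rw [h5] at this
      exact_mod_cast this
    have h4 : M * α ≤ δ / 2 := by
      rw [hαd, mul_div_assoc', div_le_div_iff₀ (by positivity) (by norm_num)]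
      nlinarith [(Nat.cast_nonneg M : (0:ℝ) ≤ M)]
    linarith
  have hpt : ∀ t, K (gev x t) ≤ 4 * C * ‖gev hi t‖ ^ 2 := by
    intro t
    have hC := h.C0
    rcases lt_or_ge ‖gev x t‖ δ with hlt | hge
    · rw [h.Kδ _ hlt]; positivity
    · have h1 : gev x t = gev lo t + gev hi t := by rw [← gev_add, hsum]
      have h2 : ‖gev x t‖ ≤ ‖gev lo t‖ + ‖gev hi t‖ := h1 ▸ norm_add_le _ _
      have h3 : ‖gev x t‖ ≤ 2 * ‖gev hi t‖ := by linarith [hlo t]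
      have h4 : ‖gev x t‖ ^ 2 ≤ (2 * ‖gev hi t‖) ^ 2 := pow_le_pow_left₀ (norm_nonneg _) h3 2
      have := h.KC (gev x t)
      nlinarith
  have hintK : ∫ t, K (gev x t) ∂(haarAddCircle : Measure UnitAddCircle) ≤ 4 * C * ∑ k : S, ‖hi k‖ ^ 2 := by
    rw [← ga_parseval, ← integral_const_mul]
    have c1 := gev_cont x
    have c2 := gev_cont hi
    have := h.Kc
    exact integral_mono (ga_integrable (by fun_prop)) (ga_integrable (by fun_prop)) hpt
  have hterm : ∀ k : S, Real.pi * ‖x k‖ ^ 2 ≤ Real.pi * ((k : ℝ) * ‖x k‖ ^ 2) - 4 * C * ‖hi k‖ ^ 2 := by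
    intro k
    have hp := Real.pi_pos
    have hq := sq_nonneg ‖x k‖
    have hhk : hi k = if (k : ℤ) ≤ M then 0 else x k := rfl
    rcases le_or_gt (k : ℤ) 0 with hk0 | hk0
    · have : hi k = 0 := by rw [hhk, gNeg_orth hx k hk0]; simp
      simp [this, gNeg_orth hx k hk0]
    · have hk1 : (1 : ℝ) ≤ ((k : ℤ) : ℝ) := by exact_mod_cast hk0
      by_cases hk : (k : ℤ) ≤ M
      · have : hi k = 0 := by rw [hhk, if_pos hk]
        rw [this]
        have : ‖x k‖ ^ 2 ≤ (k : ℝ) * ‖x k‖ ^ 2 := le_mul_of_one_le_left hq hk1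
        simp only [norm_zero]
        nlinarith
      · have h5 : hi k = x k := by rw [hhk, if_neg hk]
        rw [h5]
        have h6 : (M : ℝ) + 1 ≤ ((k : ℤ) : ℝ) := by exact_mod_cast (by omega : (M : ℤ) + 1 ≤ (k : ℤ))
        have h7 : 0 ≤ Real.pi * ((k : ℝ)) - 4 * C - Real.pi := by nlinarith
        have := mul_nonneg h7 hq
        nlinarith
  have hs := Finset.sum_le_sum fun k (_ : k ∈ (Finset.univ : Finset S)) => hterm k
  rw [Finset.sum_sub_distrib, ← Finset.mul_sum, ← Finset.mul_sum, ← Finset.mul_sum,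
    ← ga_normsq, hα] at hs
  rw [gPhi]
  linarith

def gS (N : ℕ) : Finset ℤ := Finset.Icc (-(N + 1 : ℤ)) (N + 1)

theorem g_approx (h : GHyp K U W e0 C δ A B L c w0) :
    ∃ β : ℝ, 0 < β ∧ ∀ N : ℕ, ∃ x : GV (gS N) n, β ≤ gPhi K x ∧ ‖gG U x‖ < 1 / (N + 1) := by
  obtain ⟨α, hα, hΓ⟩ := gPhi_gamma h
  have hp := Real.pi_pos
  refine ⟨Real.pi * α ^ 2, by positivity, fun N => ?_⟩
  have h1 : (1 : ℤ) ∈ gS N := by rw [gS, Finset.mem_Icc]; omega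
  obtain ⟨τ, hτ⟩ := gPhi_link h h1
  have hL := h.L0
  refine mm_minimax (gNeg (gS N) n) (gE h1 e0) (gE_orth h1 e0) ?_ (gPhi K) (gPhi_cont h.Kc) (gG U)
    (gG_cont h.Uc) (2 * Real.pi * (N + 1) + L) (by positivity) (fun x v => ?_)
    (fun y hy => gPhi_neg h y hy) τ hτ α _ hα (by positivity) (fun x hx hxα => hΓ _ x hx hxα)
    _ (by positivity)
  · simp [gE, h.e01]
  · refine gPhi_desc h (N + 1) (fun k hk => ?_) x v
    rw [gS, Finset.mem_Icc] at hk
    exact_mod_cast hk.2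

end GalerkinB

/-! Part 5 -/


section GalerkinC
open MeasureTheory AddCircle Filter


variable {K : Esp n → ℝ} {U : Esp n → Esp n} {W : Esp n →L[ℂ] Esp n} {e0 : Esp n}
    {C δ A B L c w0 : ℝ}

theorem ga_bessel {S : Finset ℤ} (f : UnitAddCircle → Esp n) (hf : Continuous f) (B : ℝ)
    (hB : ∀ t, ‖f t‖ ≤ B) : ∑ k : S, ‖fourierCoeff f k‖ ^ 2 ≤ B ^ 2 := by
  let y : GV S n := WithLp.toLp 2 fun k => fourierCoeff f k
  have h1 := ga_pair f hf y
  have h2 : ∑ k : S, ⟪fourierCoeff f k, y k⟫ = ∑ k : S, ‖y k‖ ^ 2 :=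
    Finset.sum_congr rfl fun k _ => real_inner_self_eq_norm_sq _
  have c1 := gev_cont y
  have h3 : ∫ t, ⟪f t, gev y t⟫ ∂(haarAddCircle : Measure UnitAddCircle) ≤ ∫ t, (B ^ 2 / 2 + 1 / 2 * ‖gev y t‖ ^ 2) ∂(haarAddCircle : Measure UnitAddCircle) := by
    refine integral_mono (ga_integrable (by fun_prop)) (ga_integrable (by fun_prop)) fun t => ?_
    have h4 := real_inner_le_norm (f t) (gev y t)
    have h5 : ‖f t‖ ^ 2 ≤ B ^ 2 := pow_le_pow_left₀ (norm_nonneg _) (hB t) 2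
    have h6 := sq_nonneg (‖f t‖ - ‖gev y t‖)
    change ⟪f t, gev y t⟫ ≤ B ^ 2 / 2 + 1 / 2 * ‖gev y t‖ ^ 2
    nlinarith
  rw [integral_add (ga_integrable (by fun_prop)) (ga_integrable (by fun_prop)),
    integral_const_mul, ga_parseval, h1, h2] at h3
  simp only [integral_const, probReal_univ, one_smul] at h3
  change ∑ k : S, ‖y k‖ ^ 2 ≤ B ^ 2
  linarith

theorem g_bound (h : GHyp K U W e0 C δ A B L c w0) :
    ∃ M : ℝ, 0 ≤ M ∧ ∀ (S : Finset ℤ) (x : GV S n), ‖gG U x‖ ≤ 1 →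
      ∑ k : S, (1 + (k : ℝ) ^ 2) * ‖x k‖ ^ 2 ≤ M := by
  have hB : 0 ≤ B := (norm_nonneg _).trans (h.UB 0)
  have hc := h.c0
  refine ⟨((1 + B) / c) ^ 2 + (2 * (1 + B) ^ 2 + 8 * ‖W‖ ^ 2 * ((1 + B) / c) ^ 2),
    by positivity, fun S x hx => ?_⟩
  have c1 := gev_cont x
  have hUc := h.Uc
  let f : UnitAddCircle → Esp n := fun t => U (gev x t) - (2 : ℂ) • W (gev x t)
  have hf : Continuous f := by fun_prop
  let b : GV S n := WithLp.toLp 2 fun k => fourierCoeff f k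
  have hb : ‖b‖ ≤ B := by
    have h1 := ga_bessel (S := S) f hf B fun t => h.UB _
    have h2 : ‖b‖ ^ 2 ≤ B ^ 2 := by rw [ga_normsq]; exact h1
    exact (sq_le_sq₀ (norm_nonneg _) hB).1 h2
  let r : GV S n := gG U x + b
  have hr : ‖r‖ ≤ 1 + B := (norm_add_le _ _).trans (add_le_add hx hb)
  have hbk : ∀ k : S, b k = fourierCoeff (fun t => U (gev x t)) k - (2 : ℂ) • W (x k) := by
    intro k
    change fourierCoeff f k = _
    have h1 : ∀ t, fourier (-(k : ℤ)) t • f t = fourier (-(k : ℤ)) t • U (gev x t)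
        - (2 : ℂ) • W (fourier (-(k : ℤ)) t • gev x t) := by
      intro t
      simp only [f, smul_sub, map_smul]
      rw [smul_comm]
    have i1 : Integrable (fun t => fourier (-(k : ℤ)) t • U (gev x t)) (haarAddCircle : Measure UnitAddCircle) :=
      ga_integrable (by fun_prop)
    have i2 : Integrable (fun t => fourier (-(k : ℤ)) t • gev x t) (haarAddCircle : Measure UnitAddCircle) :=
      ga_integrable (by fun_prop)
    have i3 : Integrable (fun t => (2 : ℂ) • W (fourier (-(k : ℤ)) t • gev x t)) (haarAddCircle : Measure UnitAddCircle) :=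
      ga_integrable (by fun_prop)
    have h2 : fourierCoeff f k = ∫ t, (fourier (-(k : ℤ)) t • U (gev x t)
        - (2 : ℂ) • W (fourier (-(k : ℤ)) t • gev x t)) ∂(haarAddCircle : Measure UnitAddCircle) := by
      simp only [fourierCoeff, h1]
    rw [h2, integral_sub i1 i3, integral_smul, W.integral_comp_comm i2, ← ga_coeff_mem x k]
    rfl
  have hrk : ∀ k : S, r k = ((2 * Real.pi * (k : ℤ) : ℝ) : ℂ) • x k - (2 : ℂ) • W (x k) := by
    intro k
    have : r k = gG U x k + b k := rfl
    rw [this, hbk]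
    simp only [gG, Complex.coe_smul]
    abel
  have hxr : c * ‖x‖ ≤ ‖r‖ := by
    have h1 : (c * ‖x‖) ^ 2 ≤ ‖r‖ ^ 2 := by
      rw [mul_pow, ga_normsq, ga_normsq, Finset.mul_sum]
      refine Finset.sum_le_sum fun k _ => ?_
      rw [← mul_pow, hrk]
      exact pow_le_pow_left₀ (by positivity) (h.res k (x k)) 2
    exact (sq_le_sq₀ (by positivity) (norm_nonneg _)).1 h1
  have hxR : ‖x‖ ≤ (1 + B) / c := by
    rw [le_div_iff₀' hc]; exact hxr.trans hr
  have hterm : ∀ k : S, (1 + (k : ℝ) ^ 2) * ‖x k‖ ^ 2 ≤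
      ‖x k‖ ^ 2 + (2 * ‖r k‖ ^ 2 + 8 * ‖W‖ ^ 2 * ‖x k‖ ^ 2) := by
    intro k
    have h1 : ((2 * Real.pi * (k : ℤ) : ℝ) : ℂ) • x k = r k + (2 : ℂ) • W (x k) := by
      rw [hrk]; abel
    have h2 : ‖((2 * Real.pi * (k : ℤ) : ℝ) : ℂ) • x k‖ ≤ ‖r k‖ + 2 * (‖W‖ * ‖x k‖) := by
      rw [h1]
      refine (norm_add_le _ _).trans (add_le_add le_rfl ?_)
      rw [norm_smul]
      have := W.le_opNorm (x k)
      simpa using this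
    have h3 : ‖((2 * Real.pi * (k : ℤ) : ℝ) : ℂ) • x k‖ ^ 2 = (2 * Real.pi) ^ 2 * ((k : ℝ) ^ 2 * ‖x k‖ ^ 2) := by
      rw [norm_smul, Complex.norm_real, Real.norm_eq_abs, mul_pow, sq_abs]; ring
    have h4 := pow_le_pow_left₀ (norm_nonneg _) h2 2
    rw [h3] at h4
    have h5 : 0 ≤ (k : ℝ) ^ 2 * ‖x k‖ ^ 2 := by positivity
    have h6 : 1 ≤ (2 * Real.pi) ^ 2 := by nlinarith [Real.pi_gt_three]
    have h7 := mul_le_mul_of_nonneg_right h6 h5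
    have h8 := sq_nonneg (‖r k‖ - 2 * (‖W‖ * ‖x k‖))
    nlinarith
  have hs := Finset.sum_le_sum fun k (_ : k ∈ (Finset.univ : Finset S)) => hterm k
  rw [Finset.sum_add_distrib, Finset.sum_add_distrib, ← Finset.mul_sum, ← Finset.mul_sum,
    ← ga_normsq, ← ga_normsq] at hs
  have h1 : ‖x‖ ^ 2 ≤ ((1 + B) / c) ^ 2 := pow_le_pow_left₀ (norm_nonneg _) hxR 2
  have h2 : ‖r‖ ^ 2 ≤ (1 + B) ^ 2 := pow_le_pow_left₀ (norm_nonneg _) hr 2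
  have h3 := mul_le_mul_of_nonneg_left h1 (by positivity : 0 ≤ 8 * ‖W‖ ^ 2)
  linarith

theorem ga_summable : Summable fun k : ℤ => 1 / (1 + (k : ℝ) ^ 2) := by
  have h1 : Summable fun k : ℤ => 1 / (k : ℝ) ^ 2 := Real.summable_one_div_int_pow.2 one_lt_two
  have h2 : Summable (Pi.single (0 : ℤ) (1 : ℝ)) := (hasSum_pi_single 0 1).summable
  refine Summable.of_nonneg_of_le (fun k => by positivity) (fun k => ?_) (h1.add h2)
  by_cases hk : k = 0
  · subst hk; simp
  · have : (0:ℝ) < (k : ℝ) ^ 2 := by positivity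
    simp only [Pi.single_apply, hk, if_false, add_zero]
    exact one_div_le_one_div_of_le this (by linarith)

theorem ga_cs {S : Finset ℤ} (x : GV S n) (a : ℤ → ℂ) (R : ℝ) (ha : ∀ k, ‖a k‖ ^ 2 ≤ R) :
    ‖∑ k : S, a k • x k‖ ^ 2 ≤ (∑ k : S, (1 + (k : ℝ) ^ 2) * ‖x k‖ ^ 2) *
      ∑' k : ℤ, ‖a k‖ ^ 2 * (1 / (1 + (k : ℝ) ^ 2)) := by
  have hsum : Summable fun k : ℤ => ‖a k‖ ^ 2 * (1 / (1 + (k : ℝ) ^ 2)) := by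
    refine Summable.of_nonneg_of_le (fun k => by positivity) (fun k => ?_) (ga_summable.mul_left R)
    exact mul_le_mul_of_nonneg_right (ha k) (by positivity)
  have h1 : ‖∑ k : S, a k • x k‖ ≤ ∑ k : S, (Real.sqrt (1 + (k : ℝ) ^ 2) * ‖x k‖) *
      (‖a k‖ / Real.sqrt (1 + (k : ℝ) ^ 2)) := by
    refine (norm_sum_le _ _).trans (Finset.sum_le_sum fun k _ => ?_)
    have : 0 < Real.sqrt (1 + ((k : ℤ) : ℝ) ^ 2) := by positivity
    rw [norm_smul]
    apply le_of_eq
    field_simp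
  have h2 := pow_le_pow_left₀ (norm_nonneg _) h1 2
  refine h2.trans ((Finset.sum_mul_sq_le_sq_mul_sq _ _ _).trans ?_)
  have h3 : ∑ k : S, (Real.sqrt (1 + (k : ℝ) ^ 2) * ‖x k‖) ^ 2 =
      ∑ k : S, (1 + (k : ℝ) ^ 2) * ‖x k‖ ^ 2 := by
    refine Finset.sum_congr rfl fun k _ => ?_
    rw [mul_pow, Real.sq_sqrt (by positivity)]
  have h4 : ∑ k : S, (‖a k‖ / Real.sqrt (1 + (k : ℝ) ^ 2)) ^ 2 =
      ∑ k ∈ S, ‖a k‖ ^ 2 * (1 / (1 + (k : ℝ) ^ 2)) := by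
    rw [← Finset.sum_coe_sort S]
    refine Finset.sum_congr rfl fun k _ => ?_
    rw [div_pow, Real.sq_sqrt (by positivity)]; ring
  rw [h3, h4]
  refine mul_le_mul_of_nonneg_left (hsum.sum_le_tsum S fun k _ => by positivity) ?_
  exact Finset.sum_nonneg fun k _ => by positivity

def gom (t : UnitAddCircle) : ℝ :=
  ∑' k : ℤ, ‖fourier k t - 1‖ ^ 2 * (1 / (1 + (k : ℝ) ^ 2))

theorem ga_four (k : ℤ) (t : UnitAddCircle) : ‖fourier k t - 1‖ ^ 2 ≤ 4 := by
  have h1 : ‖fourier k t - 1‖ ≤ 2 := by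
    refine (norm_sub_le _ _).trans ?_
    rw [ga_norm_fourier]; norm_num
  nlinarith [norm_nonneg (fourier k t - 1)]

theorem gom_cont : Continuous gom := by
  unfold gom
  refine continuous_tsum (fun k => by fun_prop) (ga_summable.mul_left 4) fun k t => ?_
  rw [Real.norm_of_nonneg (by positivity)]
  exact mul_le_mul_of_nonneg_right (ga_four k t) (by positivity)

theorem gom_zero : gom 0 = 0 := by
  simp [gom]

theorem gev_diff {S : Finset ℤ} (x : GV S n) (M : ℝ)
    (hM : ∑ k : S, (1 + (k : ℝ) ^ 2) * ‖x k‖ ^ 2 ≤ M) (s t : UnitAddCircle) :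
    ‖gev x t - gev x s‖ ^ 2 ≤ M * gom (t - s) := by
  have h1 : gev x t - gev x s = ∑ k : S, (fourier (k : ℤ) t - fourier (k : ℤ) s) • x k := by
    simp [gev, sub_smul, Finset.sum_sub_distrib]
  have h2 : ∀ k : ℤ, ‖fourier k t - fourier k s‖ = ‖fourier k (t - s) - 1‖ := by
    intro k
    have h3 : fourier k t = fourier k s * fourier k (t - s) := by
      conv_lhs => rw [show t = s + (t - s) by abel]
      rw [fourier_apply, fourier_apply, fourier_apply, smul_add, toCircle_add, Circle.coe_mul]
    rw [h3, show fourier k s * fourier k (t - s) - fourier k s =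
      fourier k s * (fourier k (t - s) - 1) by ring, norm_mul, ga_norm_fourier, one_mul]
  rw [h1]
  refine (ga_cs x (fun k => fourier k t - fourier k s) 4 fun k => ?_).trans ?_
  · rw [h2]; exact ga_four _ _
  · simp only [h2]
    exact mul_le_mul_of_nonneg_right hM (tsum_nonneg fun k => by positivity)

theorem gev_sup {S : Finset ℤ} (x : GV S n) (M : ℝ)
    (hM : ∑ k : S, (1 + (k : ℝ) ^ 2) * ‖x k‖ ^ 2 ≤ M) (t : UnitAddCircle) :
    ‖gev x t‖ ^ 2 ≤ M * ∑' k : ℤ, 1 / (1 + (k : ℝ) ^ 2) := by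
  refine (ga_cs x (fun k => fourier k t) 1 fun k => ?_).trans ?_
  · rw [ga_norm_fourier]; norm_num
  · simp only [ga_norm_fourier, one_pow, one_mul]
    exact mul_le_mul_of_nonneg_right hM (tsum_nonneg fun k => by positivity)

theorem g_limit (h : GHyp K U W e0 C δ A B L c w0) :
    ∃ β : ℝ, 0 < β ∧ ∃ R : ℝ, ∃ φ : ℕ → ℕ, StrictMono φ ∧ ∃ x : ∀ N : ℕ, GV (gS N) n,
      ∃ X : UnitAddCircle → Esp n, Continuous X ∧ (∀ N, β ≤ gPhi K (x N)) ∧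
      (∀ N : ℕ, ‖gG U (x N)‖ < 1 / (N + 1)) ∧ (∀ N, ‖x N‖ ≤ R) ∧
      (∀ N t, ‖gev (x N) t‖ ≤ R) ∧
      ∀ t, Tendsto (fun j => gev (x (φ j)) t) atTop (𝓝 (X t)) := by
  obtain ⟨β, hβ, hx⟩ := g_approx h
  choose x hxΦ hxG using hx
  obtain ⟨M, hM0, hM⟩ := g_bound h
  have hxM : ∀ N, ∑ k : gS N, (1 + (k : ℝ) ^ 2) * ‖x N k‖ ^ 2 ≤ M := by
    intro N
    refine hM _ _ ((hxG N).le.trans ?_)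
    rw [div_le_one (by positivity)]
    linarith [(Nat.cast_nonneg N : (0:ℝ) ≤ N)]
  set sg := ∑' k : ℤ, 1 / (1 + (k : ℝ) ^ 2) with hsg
  have hsg0 : 0 ≤ sg := tsum_nonneg fun k => by positivity
  set R := M * sg + M + 1 with hR
  have hR1 : 1 ≤ R := by have := mul_nonneg hM0 hsg0; linarith
  have hsq : ∀ a : ℝ, 0 ≤ a → a ^ 2 ≤ R → a ≤ R := by
    intro a ha h2
    by_contra hc
    push Not at hc
    nlinarith
  have hxR : ∀ N, ‖x N‖ ≤ R := by
    intro N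
    refine hsq _ (norm_nonneg _) ?_
    rw [ga_normsq]
    have h1 : ∑ k : gS N, ‖x N k‖ ^ 2 ≤ ∑ k : gS N, (1 + (k : ℝ) ^ 2) * ‖x N k‖ ^ 2 := by
      refine Finset.sum_le_sum fun k _ => ?_
      have : 0 ≤ ((k : ℤ) : ℝ) ^ 2 * ‖x N k‖ ^ 2 := by positivity
      linarith
    have := mul_nonneg hM0 hsg0
    linarith [hxM N]
  have hxS : ∀ N t, ‖gev (x N) t‖ ≤ R := by
    intro N t
    refine hsq _ (norm_nonneg _) ?_
    linarith [gev_sup (x N) M (hxM N) t]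
  let F : ℕ → BoundedContinuousFunction UnitAddCircle (Esp n) := fun N =>
    BoundedContinuousFunction.mkOfCompact ⟨gev (x N), gev_cont (x N)⟩
  have hcomp : IsCompact (closure (Set.range F)) := by
    refine BoundedContinuousFunction.arzela_ascoli (closedBall (0 : Esp n) R)
      (isCompact_closedBall _ _) _ ?_ ?_
    · rintro f t ⟨N, rfl⟩
      rw [mem_closedBall_zero_iff]
      exact hxS N t
    · intro t0
      rw [Metric.equicontinuousAt_iff]
      intro ε hε
      have hcont : Tendsto (fun t => M * gom (t - t0)) (𝓝 t0) (𝓝 0) := by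
        have : Continuous fun t => M * gom (t - t0) :=
          continuous_const.mul (gom_cont.comp (by fun_prop))
        have h2 := this.tendsto t0
        simpa [gom_zero] using h2
      have hev : ∀ᶠ t in 𝓝 t0, M * gom (t - t0) < ε ^ 2 :=
        hcont.eventually (gt_mem_nhds (by positivity))
      obtain ⟨d, hd, hball⟩ := Metric.eventually_nhds_iff.1 hev
      refine ⟨d, hd, fun t ht => ?_⟩
      rintro ⟨_, N, rfl⟩
      have h1 := (gev_diff (x N) M (hxM N) t0 t).trans_lt (hball ht)
      change dist (gev (x N) t0) (gev (x N) t) < ε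
      rw [dist_comm, dist_eq_norm]
      exact lt_of_pow_lt_pow_left₀ 2 hε.le h1
  obtain ⟨f, _, φ, hφ, hlim⟩ := hcomp.tendsto_subseq (x := F) fun N => subset_closure ⟨N, rfl⟩
  refine ⟨β, hβ, R, φ, hφ, x, f, f.continuous, hxΦ, hxG, hxR, hxS, fun t => ?_⟩
  exact (BoundedContinuousFunction.tendsto_iff_tendstoUniformly.1 hlim).tendsto_at t

end GalerkinC

/-! Part 6 -/


section GalerkinD
open MeasureTheory AddCircle Filter


variable {K : Esp n → ℝ} {U : Esp n → Esp n} {W : Esp n →L[ℂ] Esp n} {e0 : Esp n}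
    {C δ A B L c w0 : ℝ}

theorem esp_hasDerivAt {f : ℝ → Esp n} {f' : Esp n} {t : ℝ}
    (h : ∀ i, HasDerivAt (fun t => f t i) (f' i) t) : HasDerivAt f f' t := by
  have h1 : HasDerivAt (fun t => (f t).ofLp) f'.ofLp t := hasDerivAt_pi.2 h
  have h2 := (PiLp.continuousLinearEquiv 2 ℝ (fun _ : Fin n => ℂ)).symm.hasFDerivAt.comp_hasDerivAt t h1
  exact h2

theorem esp_hasDerivAt_apply {f : ℝ → Esp n} {f' : Esp n} {t : ℝ}
    (h : HasDerivAt f f' t) (i : Fin n) : HasDerivAt (fun t => f t i) (f' i) t :=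
  ((EuclideanSpace.proj (𝕜 := ℂ) i).restrictScalars ℝ).hasFDerivAt.comp_hasDerivAt t h

theorem ga_int01 {E : Type*} [NormedAddCommGroup E] [NormedSpace ℂ E] (f : UnitAddCircle → E) (k : ℤ) :
    fourierCoeff f k = ∫ x in (0:ℝ)..1, fourier (-k) (x : UnitAddCircle) • f x := by
  have := fourierCoeff_eq_intervalIntegral f k 0
  simpa using this

theorem ode_scalar (u g : UnitAddCircle → ℂ) (hu : Continuous u) (hg : Continuous g)
    (hc : ∀ k : ℤ, (2 * Real.pi * k : ℂ) * fourierCoeff u k = fourierCoeff g k) (t : ℝ) :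
    HasDerivAt (fun t : ℝ => u t) (Complex.I * g t) t := by
  have hgc : Continuous fun s : ℝ => Complex.I * g s :=
    continuous_const.mul (hg.comp (AddCircle.continuous_mk' 1))
  let y : ℝ → ℂ := fun t => ∫ s in (0:ℝ)..t, Complex.I * g s
  have hy : ∀ t : ℝ, HasDerivAt y (Complex.I * g t) t := fun t =>
    (hgc.integral_hasStrictDerivAt 0 t).hasDerivAt
  have hyc : Continuous y := continuous_iff_continuousAt.2 fun t => (hy t).continuousAt
  have hper0 : Function.Periodic (fun s : ℝ => Complex.I * g s) 1 := by
    intro s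
    have : ((s + 1 : ℝ) : UnitAddCircle) = s := AddCircle.coe_add_period 1 s
    simp only [this]
  have hg0 : ∫ s in (0:ℝ)..1, Complex.I * g s = 0 := by
    have h0 := hc 0
    rw [ga_int01 g 0] at h0
    simp only [Int.cast_zero, mul_zero, zero_mul, neg_zero, fourier_zero, one_smul] at h0
    rw [intervalIntegral.integral_const_mul, ← h0, mul_zero]
  have hper : Function.Periodic y 1 := by
    intro t
    have h1 := hper0.intervalIntegral_add_eq t 0
    rw [zero_add, hg0] at h1
    have h2 := intervalIntegral.integral_add_adjacent_intervals
      (hgc.intervalIntegrable (μ := volume) 0 t) (hgc.intervalIntegrable t (t + 1))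
    rw [h1, add_zero] at h2
    exact h2.symm
  let Y : UnitAddCircle → ℂ := hper.lift
  have hYt : ∀ t : ℝ, Y t = y t := fun t => hper.lift_coe t
  have hYc : Continuous Y := Continuous.quotient_liftOn' hyc _
  have hYk : ∀ k : ℤ, k ≠ 0 → fourierCoeff Y k = fourierCoeff u k := by
    intro k hk
    have hd : ∀ s : ℝ, HasDerivAt (fun s : ℝ => fourier (-k) (s : UnitAddCircle) * y s)
        (-2 * Real.pi * Complex.I * k * (fourier (-k) (s : UnitAddCircle) • Y s) +
          Complex.I * (fourier (-k) (s : UnitAddCircle) • g s)) s := by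
      intro s
      have h1 := (hasDerivAt_fourier_neg 1 k s).mul (hy s)
      refine h1.congr_deriv ?_
      rw [hYt]
      simp only [smul_eq_mul, Complex.ofReal_one, div_one]
      ring
    have cm := AddCircle.continuous_mk' (1:ℝ)
    have c1 : Continuous fun s : ℝ => fourier (-k) (s : UnitAddCircle) • Y s :=
      ((map_continuous (fourier (-k))).comp cm).smul (hYc.comp cm)
    have c2 : Continuous fun s : ℝ => fourier (-k) (s : UnitAddCircle) • g s :=
      ((map_continuous (fourier (-k))).comp cm).smul (hg.comp cm)
    have c3 : Continuous fun s : ℝ => -2 * Real.pi * Complex.I * k *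
        (fourier (-k) (s : UnitAddCircle) • Y s) := continuous_const.mul c1
    have c4 : Continuous fun s : ℝ => Complex.I * (fourier (-k) (s : UnitAddCircle) • g s) :=
      continuous_const.mul c2
    have h2 := intervalIntegral.integral_eq_sub_of_hasDerivAt (a := 0) (b := 1)
      (fun s _ => hd s) ((c3.add c4).intervalIntegrable _ _)
    have h3 : fourier (-k) ((1 : ℝ) : UnitAddCircle) * y 1 -
        fourier (-k) ((0 : ℝ) : UnitAddCircle) * y 0 = 0 := by
      have h4 : y 1 = y 0 := by simpa using hper 0
      have h5 : ((1 : ℝ) : UnitAddCircle) = ((0 : ℝ) : UnitAddCircle) := by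
        simp
      rw [h4, h5, sub_self]
    rw [h3, intervalIntegral.integral_add (c3.intervalIntegrable _ _)
      (c4.intervalIntegrable _ _), intervalIntegral.integral_const_mul,
      intervalIntegral.integral_const_mul, ← ga_int01, ← ga_int01, ← hc k] at h2
    have hk' : (k : ℂ) ≠ 0 := by exact_mod_cast hk
    have hp : (Real.pi : ℂ) ≠ 0 := by exact_mod_cast Real.pi_ne_zero
    have h6 : (2 * Real.pi * Complex.I * k) * (fourierCoeff u k - fourierCoeff Y k) = 0 := by
      rw [← h2]; ring
    rcases mul_eq_zero.1 h6 with h7 | h7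
    · exfalso
      simp [hk', hp, Complex.I_ne_zero] at h7
    · exact (sub_eq_zero.1 h7).symm
  let d : C(UnitAddCircle, ℂ) := ⟨fun t => u t - Y t, hu.sub hYc⟩
  have hdk : ∀ k : ℤ, k ≠ 0 → fourierCoeff d k = 0 := by
    intro k hk
    have : fourierCoeff d k = fourierCoeff u k - fourierCoeff Y k := by
      simp only [fourierCoeff]
      rw [← integral_sub (ga_integrable (by fun_prop)) (ga_integrable (by fun_prop))]
      simp only [d, ContinuousMap.coe_mk, smul_sub]
    rw [this, hYk k hk, sub_self]
  have hconst : ∀ t, d t = fourierCoeff d 0 := by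
    intro t
    have hs : Summable (fourierCoeff d) :=
      summable_of_ne_finset_zero (s := {0}) fun k hk => hdk k (by simpa using hk)
    have h1 := has_pointwise_sum_fourier_series_of_summable hs t
    have h2 : HasSum (fun i => fourierCoeff d i • fourier i t) (fourierCoeff d 0 • fourier 0 t) :=
      hasSum_single 0 fun k hk => by rw [hdk k hk, zero_smul]
    rw [h1.unique h2]; simp
  have hfin : (fun t : ℝ => u t) = fun t => fourierCoeff d 0 + y t := by
    funext t
    rw [← hconst t, ← hYt]
    simp [d]
  rw [hfin]
  exact (hy t).const_add _

theorem ga_dct {E : Type*} [NormedAddCommGroup E] [NormedSpace ℝ E]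
    (g : UnitAddCircle → Esp n → E) (hg : Continuous (Function.uncurry g))
    (Xj : ℕ → UnitAddCircle → Esp n) (hXj : ∀ j, Continuous (Xj j)) (X : UnitAddCircle → Esp n)
    (R : ℝ) (hR : ∀ j t, ‖Xj j t‖ ≤ R) (hlim : ∀ t, Tendsto (fun j => Xj j t) atTop (𝓝 (X t))) :
    Tendsto (fun j => ∫ t, g t (Xj j t) ∂(haarAddCircle : Measure UnitAddCircle)) atTop (𝓝 (∫ t, g t (X t) ∂(haarAddCircle : Measure UnitAddCircle))) := by
  obtain ⟨b, hb⟩ := ((isCompact_univ (X := UnitAddCircle)).prod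
    (isCompact_closedBall (0 : Esp n) R)).exists_bound_of_continuousOn hg.continuousOn
  refine tendsto_integral_of_dominated_convergence (fun _ => b) (fun j => ?_)
    (integrable_const b) (fun j => Eventually.of_forall fun t => ?_)
    (Eventually.of_forall fun t => ?_)
  · exact (ga_integrable (hg.comp (continuous_id.prodMk (hXj j)))).aestronglyMeasurable
  · exact hb (t, Xj j t) ⟨mem_univ _, by rw [mem_closedBall_zero_iff]; exact hR j t⟩
  · have : Continuous fun y => g t y := hg.comp (by fun_prop : Continuous fun y => (t, y))
    exact (this.tendsto _).comp (hlim t)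

theorem gPhi_value (h : GHyp K U W e0 C δ A B L c w0) {S : Finset ℤ} (x : GV S n) :
    gPhi K x = 1 / 2 * ⟪gG U x, x⟫ + ∫ t, (1 / 2 * ⟪U (gev x t), gev x t⟫ - K (gev x t)) ∂(haarAddCircle : Measure UnitAddCircle) := by
  have c1 : Continuous fun t => K (gev x t) := h.Kc.comp (gev_cont x)
  have c2 : Continuous fun t => U (gev x t) := h.Uc.comp (gev_cont x)
  have c3 := gev_cont x
  have c4 : Continuous fun t => 1 / 2 * ⟪U (gev x t), gev x t⟫ := continuous_const.mul (c2.inner c3)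
  have h2 : ⟪gG U x, x⟫ = 2 * Real.pi * ∑ k : S, (k : ℝ) * ‖x k‖ ^ 2
      - ∑ k : S, ⟪fourierCoeff (fun t => U (gev x t)) k, x k⟫ := by
    rw [PiLp.inner_apply, Finset.mul_sum, ← Finset.sum_sub_distrib]
    refine Finset.sum_congr rfl fun k _ => ?_
    simp only [gG, inner_sub_left, real_inner_smul_left, real_inner_self_eq_norm_sq]
    ring
  rw [integral_sub (ga_integrable c4) (ga_integrable c1), integral_const_mul, ga_pair _ c2, h2, gPhi]
  ring

theorem g_main (h : GHyp K U W e0 C δ A B L c w0) :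
    ∃ X : UnitAddCircle → Esp n, Continuous X ∧
      (∀ t : ℝ, HasDerivAt (fun t : ℝ => X t) (Complex.I • U (X t)) t) ∧
      0 < ∫ t, (1 / 2 * ⟪U (X t), X t⟫ - K (X t)) ∂(haarAddCircle : Measure UnitAddCircle) := by
  obtain ⟨β, hβ, R, φ, hφ, x, X, hX, hxΦ, hxG, hxR, hxS, hlim⟩ := g_limit h
  have hUc := h.Uc
  have hKc := h.Kc
  have hφ0 : Tendsto (fun j => 1 / ((φ j : ℝ) + 1)) atTop (𝓝 0) :=
    tendsto_one_div_add_atTop_nhds_zero_nat.comp hφ.tendsto_atTop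
  have hdct : ∀ {E : Type} [NormedAddCommGroup E] [NormedSpace ℝ E]
    (g : UnitAddCircle → Esp n → E) (hg : Continuous (Function.uncurry g)),
    Tendsto (fun j => ∫ t, g t (gev (x (φ j)) t) ∂(haarAddCircle : Measure UnitAddCircle)) atTop (𝓝 (∫ t, g t (X t) ∂(haarAddCircle : Measure UnitAddCircle))) :=
    fun g hg => ga_dct g hg _ (fun j => gev_cont _) X R (fun j t => hxS _ t) hlim
  refine ⟨X, hX, ?_, ?_⟩
  · have hcoef : ∀ k : ℤ, (2 * Real.pi * k : ℝ) • fourierCoeff X k =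
        fourierCoeff (fun t => U (X t)) k := by
      intro k
      have t1 : Tendsto (fun j => fourierCoeff (gev (x (φ j))) k) atTop (𝓝 (fourierCoeff X k)) :=
        hdct (fun t y => fourier (-k) t • y) (by fun_prop)
      have t2 : Tendsto (fun j => fourierCoeff (fun t => U (gev (x (φ j)) t)) k) atTop
          (𝓝 (fourierCoeff (fun t => U (X t)) k)) :=
        hdct (fun t y => fourier (-k) t • U y) (by fun_prop)
      have t3 := ((t1.const_smul (2 * Real.pi * k : ℝ)).sub t2).norm
      have hev : ∀ᶠ j in atTop, ‖(2 * Real.pi * k : ℝ) • fourierCoeff (gev (x (φ j))) k -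
          fourierCoeff (fun t => U (gev (x (φ j)) t)) k‖ ≤ 1 / ((φ j : ℝ) + 1) := by
        filter_upwards [eventually_ge_atTop k.natAbs] with j hj
        have hj2 := hφ.le_apply (x := j)
        have hk : k ∈ gS (φ j) := by rw [gS, Finset.mem_Icc]; omega
        have h1 := (PiLp.norm_apply_le (gG U (x (φ j))) ⟨k, hk⟩).trans (hxG (φ j)).le
        have h2 : gG U (x (φ j)) ⟨k, hk⟩ = (2 * Real.pi * k : ℝ) • fourierCoeff (gev (x (φ j))) k -
          fourierCoeff (fun t => U (gev (x (φ j)) t)) k := by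
          rw [ga_coeff_mem (x (φ j)) ⟨k, hk⟩]; rfl
        rwa [h2] at h1
      have h3 := le_of_tendsto_of_tendsto t3 hφ0 hev
      exact sub_eq_zero.1 (norm_le_zero_iff.1 h3)
    intro t
    refine esp_hasDerivAt fun i => ?_
    have hproj : ∀ (f : UnitAddCircle → Esp n), Continuous f → ∀ k : ℤ,
        fourierCoeff (fun t => f t i) k = (fourierCoeff f k) i := by
      intro f hf k
      have h1 : Integrable (fun t => fourier (-k) t • f t) (haarAddCircle : Measure UnitAddCircle) := ga_integrable (by fun_prop)
      have := (EuclideanSpace.proj (𝕜 := ℂ) i).integral_comp_comm h1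
      simpa [fourierCoeff] using this
    have hUX : Continuous fun t => U (X t) := by fun_prop
    refine (ode_scalar (fun t => X t i) (fun t => U (X t) i) (by fun_prop) (by fun_prop)
      (fun k => ?_) t)
    rw [hproj X hX, hproj _ hUX, ← hcoef]
    simp
  · have t1 := hdct (fun _ y => 1 / 2 * ⟪U y, y⟫ - K y) (by fun_prop)
    have t2 : Tendsto (fun j => 1 / 2 * (1 / ((φ j : ℝ) + 1) * R)) atTop (𝓝 (1 / 2 * (0 * R))) :=
      (hφ0.mul_const R).const_mul _
    have t3 := t2.add t1
    have h1 : β ≤ 1 / 2 * (0 * R) + ∫ t, (1 / 2 * ⟪U (X t), X t⟫ - K (X t)) ∂(haarAddCircle : Measure UnitAddCircle) := by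
      refine ge_of_tendsto' t3 fun j => ?_
      have h2 := hxΦ (φ j)
      rw [gPhi_value h] at h2
      have h3 : ⟪gG U (x (φ j)), x (φ j)⟫ ≤ 1 / ((φ j : ℝ) + 1) * R :=
        (real_inner_le_norm _ _).trans (mul_le_mul (hxG _).le (hxR _) (norm_nonneg _)
          (by positivity))
      linarith
    linarith

end GalerkinD

/-! Part 7 -/

section QuadForm

/-- The quadratic form defining the ellipsoid. -/
def qE (r : Fin n → ℝ) (z : Esp n) : ℝ := ∑ i, ‖z i‖ ^ 2 / (r i) ^ 2

/-- The associated diagonal operator. -/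
def WE (r : Fin n → ℝ) : Esp n →L[ℂ] Esp n :=
  LinearMap.toContinuousLinearMap
    { toFun := fun y => WithLp.toLp 2 (fun i => ((1 / r i ^ 2 : ℝ) : ℂ) * y i)
      map_add' := fun x y => by ext i; simp [mul_add]
      map_smul' := fun c x => by ext i; simp [mul_left_comm] }

theorem WE_apply (r : Fin n → ℝ) (y : Esp n) (i : Fin n) :
    WE r y i = ((1 / r i ^ 2 : ℝ) : ℂ) * y i := rfl

theorem esp_inner (x y : Esp n) : ⟪x, y⟫ = ∑ i, ⟪x i, y i⟫ := PiLp.inner_apply _ _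

theorem WE_inner_self (r : Fin n → ℝ) (y : Esp n) : ⟪WE r y, y⟫ = qE r y := by
  rw [esp_inner, qE]
  refine Finset.sum_congr rfl fun i _ => ?_
  rw [WE_apply, ← Complex.real_smul, real_inner_smul_left, real_inner_self_eq_norm_sq]
  ring

theorem WE_symm (r : Fin n → ℝ) (x y : Esp n) : ⟪WE r x, y⟫ = ⟪x, WE r y⟫ := by
  rw [esp_inner, esp_inner]
  refine Finset.sum_congr rfl fun i _ => ?_
  rw [WE_apply, WE_apply, ← Complex.real_smul, ← Complex.real_smul, real_inner_smul_left,
    real_inner_smul_right]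

theorem qE_nonneg (r : Fin n → ℝ) (y : Esp n) : 0 ≤ qE r y :=
  Finset.sum_nonneg fun i _ => by positivity

theorem qE_zero (r : Fin n → ℝ) : qE r 0 = 0 := by simp [qE]

theorem qE_le (r : Fin n → ℝ) (y : Esp n) : qE r y ≤ ‖WE r‖ * ‖y‖ ^ 2 := by
  rw [← WE_inner_self]
  calc _ ≤ ‖WE r y‖ * ‖y‖ := real_inner_le_norm _ _
    _ ≤ ‖WE r‖ * ‖y‖ * ‖y‖ := by gcongr; exact (WE r).le_opNorm y
    _ = _ := by ring

theorem qE_ge (r : Fin n → ℝ) (hr : ∀ i, 0 < r i) :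
    ∃ w > 0, ∀ y : Esp n, w * ‖y‖ ^ 2 ≤ qE r y := by
  set R := ∑ i, r i ^ 2 + 1
  have hR0 : 0 < R := by
    have : 0 ≤ ∑ i, r i ^ 2 := Finset.sum_nonneg fun i _ => by positivity
    positivity
  refine ⟨1 / R, by positivity, fun y => ?_⟩
  rw [EuclideanSpace.norm_sq_eq, qE, Finset.mul_sum]
  refine Finset.sum_le_sum fun i _ => ?_
  have h1 : r i ^ 2 ≤ R := by
    have := Finset.single_le_sum (f := fun i => r i ^ 2) (fun i _ => by positivity)
      (Finset.mem_univ i)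
    simp only [R]; linarith
  have h2 := hr i
  rw [div_mul_eq_mul_div, one_mul]
  gcongr

theorem qE_add (r : Fin n → ℝ) (y v : Esp n) :
    qE r (y + v) = qE r y + 2 * ⟪WE r y, v⟫ + qE r v := by
  simp only [← WE_inner_self, map_add, inner_add_left, inner_add_right]
  have h : ⟪WE r v, y⟫ = ⟪WE r y, v⟫ := by rw [WE_symm, real_inner_comm]
  rw [h]; ring

theorem qE_contDiff (r : Fin n → ℝ) : ContDiff ℝ (⊤ : ℕ∞) (qE r) := by
  have : qE r = fun y => ⟪(WE r).restrictScalars ℝ y, y⟫ := by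
    ext y; exact (WE_inner_self r y).symm
  rw [this]
  exact ((WE r).restrictScalars ℝ).contDiff.inner ℝ contDiff_id

theorem qE_hasGradientAt (r : Fin n → ℝ) (y : Esp n) :
    HasGradientAt (qE r) ((2 : ℝ) • WE r y) y := by
  rw [hasGradientAt_iff_hasFDerivAt]
  have h1 : qE r = fun y => ⟪(WE r).restrictScalars ℝ y, y⟫ := by
    ext y; exact (WE_inner_self r y).symm
  rw [h1]
  have h2 := (((WE r).restrictScalars ℝ).hasFDerivAt (x := y)).inner ℝ (hasFDerivAt_id y)
  refine h2.congr_fderiv (ContinuousLinearMap.ext fun v => ?_)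
  have h : ⟪WE r v, y⟫ = ⟪WE r y, v⟫ := by rw [WE_symm, real_inner_comm]
  simp [real_inner_smul_left, fderivInnerCLM_apply, h]
  ring

theorem qE_compact (r : Fin n → ℝ) (hr : ∀ i, 0 < r i) (s : ℝ) :
    IsCompact {y : Esp n | qE r y ≤ s} := by
  obtain ⟨w, hw, h⟩ := qE_ge r hr
  refine Metric.isCompact_of_isClosed_isBounded
    (isClosed_le (qE_contDiff r).continuous continuous_const) ?_
  refine (Metric.isBounded_closedBall (x := (0 : Esp n)) (r := s / w + 1)).subset fun y hy => ?_
  rw [mem_closedBall_zero_iff]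
  have h1 : ‖y‖ ^ 2 ≤ s / w := by
    rw [le_div_iff₀ hw]; have := h y; have h2 : qE r y ≤ s := hy; linarith
  nlinarith [sq_nonneg (‖y‖ - 1)]

theorem inner_I_smul_self (v : Esp n) : ⟪v, Complex.I • v⟫ = 0 := by
  rw [esp_inner]
  refine Finset.sum_eq_zero fun i _ => ?_
  simp [Complex.inner]
  ring

/-- Composition of `qE` with a function of one variable. -/
theorem qE_comp_hasGradientAt (r : Fin n → ℝ) {f : ℝ → ℝ} {f' : ℝ} (y : Esp n)
    (hf : HasDerivAt f f' (qE r y)) :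
    HasGradientAt (fun z => f (qE r z)) ((2 * f') • WE r y) y := by
  rw [hasGradientAt_iff_hasFDerivAt]
  have h2 := hf.comp_hasFDerivAt y (hasGradientAt_iff_hasFDerivAt.1 (qE_hasGradientAt r y))
  refine h2.congr_fderiv (ContinuousLinearMap.ext fun v => ?_)
  simp [real_inner_smul_left]
  ring

/-- Derivative of `qE` along a curve. -/
theorem qE_curve (r : Fin n → ℝ) {x : ℝ → Esp n} {x' : Esp n} {t : ℝ} (hx : HasDerivAt x x' t) :
    HasDerivAt (fun t => qE r (x t)) (2 * ⟪WE r (x t), x'⟫) t := by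
  have h := (hasGradientAt_iff_hasFDerivAt.1 (qE_hasGradientAt r (x t))).comp_hasDerivAt t hx
  refine h.congr_deriv ?_
  simp [real_inner_smul_left]

end QuadForm

/-! Part 8 -/

section UpperPrep

theorem rho_exists (m a : ℝ) (ha : 0 < a) (ham : a < m) :
    ∃ (ρ : ℝ → ℝ) (s1 s2 : ℝ), 1 < s1 ∧ ContDiff ℝ (⊤ : ℕ∞) ρ ∧ (∀ s ≤ s1, ρ s = m - a * s) ∧
      (∀ s, 0 ≤ ρ s) ∧ Antitone ρ ∧ ∀ s ≥ s2, ρ s = 0 := by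
  have h12 : 1 < m / a := by rwa [lt_div_iff₀ ha, one_mul]
  set s2 := m / a with hs2
  set s1 := (1 + s2) / 2 with hs1
  have h1 : 1 < s1 := by rw [hs1]; linarith
  have h2 : s1 < s2 := by rw [hs1]; linarith
  have hm : m = a * s2 := by rw [hs2]; field_simp
  have hz : ∀ s ≥ s2, (m - a * s) * Real.smoothTransition ((s2 - s) / (s2 - s1)) = 0 := by
    intro s hs
    rw [Real.smoothTransition.zero_of_nonpos, mul_zero]
    exact div_nonpos_of_nonpos_of_nonneg (by linarith) (by linarith)
  have hn : ∀ s, 0 ≤ (m - a * s) * Real.smoothTransition ((s2 - s) / (s2 - s1)) := by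
    intro s
    rcases le_total s2 s with hs | hs
    · rw [hz s hs]
    · refine mul_nonneg ?_ (Real.smoothTransition.nonneg _)
      rw [hm]; nlinarith
  refine ⟨fun s => (m - a * s) * Real.smoothTransition ((s2 - s) / (s2 - s1)), s1, s2, h1,
    ?_, ?_, hn, ?_, hz⟩
  · exact (contDiff_const.sub (contDiff_const.mul contDiff_id)).mul
      (Real.smoothTransition.contDiff.comp ((contDiff_const.sub contDiff_id).div_const _))
  · intro s hs
    dsimp only
    rw [Real.smoothTransition.one_of_one_le, mul_one]
    rw [le_div_iff₀ (by linarith)]; linarith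
  · intro s t hst
    dsimp only
    rcases le_total s2 t with ht | ht
    · rw [hz t ht]; exact hn s
    · have h3 : (s2 - t) / (s2 - s1) ≤ (s2 - s) / (s2 - s1) :=
        div_le_div_of_nonneg_right (by linarith) (by linarith)
      refine mul_le_mul (by nlinarith) (Real.smoothTransition.monotone h3)
        (Real.smoothTransition.nonneg _) ?_
      rw [hm]; nlinarith

theorem nonres_one (θ : ℝ) (h : ∀ k : ℤ, θ ≠ 2 * Real.pi * k) :
    ∃ c > 0, ∀ k : ℤ, c ≤ |2 * Real.pi * k - θ| := by
  have hpi := Real.pi_pos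
  set k0 := ⌊θ / (2 * Real.pi)⌋
  have h1 : 2 * Real.pi * k0 ≤ θ := by
    have := Int.floor_le (θ / (2 * Real.pi))
    rw [le_div_iff₀ (by positivity)] at this; linarith
  have h2 : θ < 2 * Real.pi * (k0 + 1) := by
    have := Int.lt_floor_add_one (θ / (2 * Real.pi))
    rw [div_lt_iff₀ (by positivity)] at this; linarith
  have h1' := lt_of_le_of_ne h1 (h k0).symm
  refine ⟨min (θ - 2 * Real.pi * k0) (2 * Real.pi * (k0 + 1) - θ),
    lt_min (by linarith) (by linarith), fun k => ?_⟩
  rcases le_or_gt k k0 with hk | hk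
  · refine (min_le_left _ _).trans ?_
    have : (k : ℝ) ≤ k0 := by exact_mod_cast hk
    have h3 : 2 * Real.pi * k ≤ 2 * Real.pi * k0 := by gcongr
    rw [abs_of_nonpos (by linarith)]; linarith
  · refine (min_le_right _ _).trans ?_
    have : (k0 : ℝ) + 1 ≤ k := by exact_mod_cast hk
    have h3 : 2 * Real.pi * (k0 + 1) ≤ 2 * Real.pi * k := by gcongr
    rw [abs_of_nonneg (by linarith)]; linarith

theorem nonres (θ : Fin n → ℝ) (h : ∀ i, ∀ k : ℤ, θ i ≠ 2 * Real.pi * k) :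
    ∃ c > 0, ∀ i, ∀ k : ℤ, c ≤ |2 * Real.pi * k - θ i| := by
  choose c hc0 hc using fun i => nonres_one (θ i) (h i)
  rcases Nat.eq_zero_or_pos n with rfl | hn
  · exact ⟨1, one_pos, fun i => i.elim0⟩
  · haveI : Nonempty (Fin n) := ⟨⟨0, hn⟩⟩
    obtain ⟨j, hj⟩ := Finite.exists_min c
    exact ⟨c j, hc0 j, fun i k => (hj i).trans (hc i k)⟩

theorem choose_a (r : Fin n → ℝ) (lo hi : ℝ) (h : lo < hi) :
    ∃ a, lo < a ∧ a < hi ∧ ∀ i, ∀ k : ℤ, a ≠ Real.pi * k * r i ^ 2 := by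
  have hc : (Set.range fun p : Fin n × ℤ => Real.pi * p.2 * r p.1 ^ 2).Countable :=
    Set.countable_range _
  obtain ⟨a, ha, h1, h2⟩ := (hc.dense_compl ℝ).exists_between h
  exact ⟨a, h1, h2, fun i k hk => ha ⟨(i, k), hk.symm⟩⟩

theorem taylor_lower (ψ : Esp n → ℝ) (h1 : ContDiff ℝ (⊤ : ℕ∞) ψ) (h2 : HasCompactSupport ψ) :
    ∃ L > 0, ∀ y v, ψ y + ⟪gradient ψ y, v⟫ - L / 2 * ‖v‖ ^ 2 ≤ ψ (y + v) := by
  obtain ⟨C, hC⟩ := ContDiff.lipschitzWith_of_hasCompactSupport (𝕂 := ℝ) (n := 1) (h2.fderiv ℝ)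
    (h1.fderiv_right (by norm_cast)) (by simp)
  refine ⟨2 * C + 1, by positivity, fun y v => ?_⟩
  have hd : Differentiable ℝ ψ := h1.differentiable (by simp)
  have key := (convex_segment y (y + v)).norm_image_sub_le_of_norm_fderiv_le' (𝕜 := ℝ)
    (f := ψ) (φ := fderiv ℝ ψ y) (C := C * ‖v‖) (x := y) (y := y + v)
    (fun x _ => hd x) (fun x hx => ?_) (left_mem_segment _ _ _) (right_mem_segment _ _ _)
  · rw [inner_gradient_left]
    rw [add_sub_cancel_left, Real.norm_eq_abs, abs_le] at key
    nlinarith [sq_nonneg ‖v‖, key.1]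
  · refine (hC.norm_sub_le x y).trans ?_
    gcongr
    have := norm_sub_le_of_mem_segment hx
    simpa using this

theorem gradient_bound (ψ : Esp n → ℝ) (h1 : ContDiff ℝ (⊤ : ℕ∞) ψ) (h2 : HasCompactSupport ψ) :
    ∃ B, ∀ y, ‖gradient ψ y‖ ≤ B := by
  obtain ⟨B, hB⟩ := (h2.fderiv ℝ).exists_bound_of_continuous (h1.continuous_fderiv (by simp))
  refine ⟨B, fun y => ?_⟩
  rw [gradient, LinearIsometryEquiv.norm_map]
  exact hB y

theorem gradient_cont (ψ : Esp n → ℝ) (h1 : ContDiff ℝ (⊤ : ℕ∞) ψ) :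
    Continuous (gradient ψ) :=
  (LinearIsometryEquiv.continuous _).comp (h1.continuous_fderiv (by simp))

end UpperPrep

/-! Part 9 -/

section Upper
open MeasureTheory AddCircle

theorem res_bound (r : Fin n → ℝ) (a c : ℝ) (hc0 : 0 < c)
    (hc : ∀ i, ∀ k : ℤ, c ≤ |2 * Real.pi * k - 2 * a / r i ^ 2|) (k : ℤ) (y : Esp n) :
    c * ‖y‖ ≤ ‖((2 * Real.pi * k : ℝ) : ℂ) • y - (2 : ℂ) • ((a : ℂ) • WE r) y‖ := by
  refine (sq_le_sq₀ (by positivity) (norm_nonneg _)).1 ?_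
  rw [mul_pow, EuclideanSpace.norm_sq_eq, EuclideanSpace.norm_sq_eq, Finset.mul_sum]
  refine Finset.sum_le_sum fun i _ => ?_
  have h1 : (((2 * Real.pi * k : ℝ) : ℂ) • y - (2 : ℂ) • ((a : ℂ) • WE r) y) i =
      ((2 * Real.pi * k - 2 * a / r i ^ 2 : ℝ) : ℂ) * y i := by
    simp only [PiLp.sub_apply, PiLp.smul_apply, smul_eq_mul, _root_.smul_apply,
      WE_apply]
    push_cast; ring
  rw [h1, norm_mul, mul_pow, Complex.norm_real, Real.norm_eq_abs]
  gcongr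
  exact hc i k

theorem upper_ghyp (r : Fin n → ℝ) (hr : ∀ i, 0 < r i) (i0 : Fin n) (H : Esp n → ℝ)
    (hH : InHclass {z : Esp n | qE r z < 1} {0} H) (a : ℝ) (ha : 0 < a)
    (hai : Real.pi * r i0 ^ 2 < a) (hares : ∀ i, ∀ k : ℤ, a ≠ Real.pi * k * r i ^ 2)
    (ρ : ℝ → ℝ) (s1 s2 : ℝ) (hs1 : 1 < s1) (hρ : ContDiff ℝ (⊤ : ℕ∞) ρ)
    (hρ1 : ∀ s ≤ s1, ρ s = H 0 - a * s) (hρ0 : ∀ s, 0 ≤ ρ s) (hρ2 : ∀ s ≥ s2, ρ s = 0) :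
    ∃ (K : Esp n → ℝ) (U : Esp n → Esp n) (W : Esp n →L[ℂ] Esp n) (e0 : Esp n)
      (C δ A B L c w0 : ℝ), GHyp K U W e0 C δ A B L c w0 ∧
      (∀ y, K y = a * qE r y + ρ (qE r y) - H y) ∧
      (∀ y, U y = (2 * (a + deriv ρ (qE r y))) • WE r y - gradient H y) := by
  obtain ⟨hHs, hHc, hHt, ⟨V, hVo, hV0, c0, hVc⟩, hHm⟩ := hH
  have hH0 : ∀ y, ¬ qE r y < 1 → H y = 0 := fun y hy =>
    image_eq_zero_of_notMem_tsupport fun h => hy (hHt h)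
  set ψ : Esp n → ℝ := fun y => ρ (qE r y) - H y with hψ
  have hψs : ContDiff ℝ (⊤ : ℕ∞) ψ := (hρ.comp (qE_contDiff r)).sub hHs
  have hψc : HasCompactSupport ψ := by
    refine HasCompactSupport.intro (qE_compact r hr (max s2 1)) fun y hy => ?_
    have hy' : max s2 1 < qE r y := not_le.1 hy
    simp only [hψ]
    rw [hρ2 _ ((le_max_left _ _).trans hy'.le), hH0 y (not_lt.2 ((le_max_right _ _).trans hy'.le)),
      sub_zero]
  have hρd : ∀ s, HasDerivAt ρ (deriv ρ s) s := fun s =>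
    (hρ.differentiable (by simp) s).hasDerivAt
  have hHg : ∀ y, HasGradientAt H (gradient H y) y := fun y =>
    (hHs.differentiable (by simp) y).hasGradientAt
  have hψg : ∀ y, gradient ψ y = (2 * deriv ρ (qE r y)) • WE r y - gradient H y := fun y => by
    refine HasGradientAt.gradient ?_
    have h1 := hasGradientAt_iff_hasFDerivAt.1 (qE_comp_hasGradientAt r y (hρd (qE r y)))
    have h2 := hasGradientAt_iff_hasFDerivAt.1 (hHg y)
    rw [hasGradientAt_iff_hasFDerivAt, map_sub]
    exact h1.sub h2
  obtain ⟨L, hL, hsec⟩ := taylor_lower ψ hψs hψc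
  obtain ⟨B, hB⟩ := gradient_bound ψ hψs hψc
  obtain ⟨P, hP⟩ := hψc.exists_bound_of_continuous hψs.continuous
  obtain ⟨w, hw, hwq⟩ := qE_ge r hr
  obtain ⟨c, hc0, hc⟩ := nonres (fun i => 2 * a / r i ^ 2) (fun i k hk => hares i k (by
    have := hr i
    rw [div_eq_iff (by positivity)] at hk
    linarith))
  obtain ⟨δ, hδ, hδV⟩ : ∃ δ > 0, ∀ y : Esp n, ‖y‖ < δ → y ∈ V ∧ qE r y < 1 := by
    have h1 : IsOpen (V ∩ {y | qE r y < 1}) :=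
      hVo.inter (isOpen_lt (qE_contDiff r).continuous continuous_const)
    obtain ⟨δ, hδ, h2⟩ := Metric.isOpen_iff.1 h1 0 ⟨hV0 rfl, by simp [qE_zero]⟩
    exact ⟨δ, hδ, fun y hy => h2 (by simpa using hy)⟩
  have hWi : ∀ y, ⟪((a : ℂ) • WE r) y, y⟫ = a * qE r y := fun y => by
    rw [_root_.smul_apply, Complex.coe_smul, real_inner_smul_left, WE_inner_self]
  have hWe : ∀ y, (2 : ℂ) • ((a : ℂ) • WE r) y = (2 * a) • WE r y := fun y => by
    rw [_root_.smul_apply, smul_smul, ← Complex.coe_smul]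
    push_cast; rfl
  have hKδ : ∀ y, ‖y‖ < δ → a * qE r y + ψ y = 0 := fun y hy => by
    obtain ⟨h1, h2⟩ := hδV y hy
    simp only [hψ]
    rw [hρ1 _ (h2.le.trans hs1.le), hVc y h1, hVc 0 (hV0 rfl)]; ring
  have hP' : ∀ y, |ψ y| ≤ P := hP
  have hP0 : 0 ≤ P := (abs_nonneg _).trans (hP' 0)
  refine ⟨fun y => a * qE r y + ψ y, fun y => (2 * a) • WE r y + gradient ψ y, (a : ℂ) • WE r,
    EuclideanSpace.single i0 1, a * ‖WE r‖ + P / δ ^ 2, δ, P, B, L, c, a * w, ?_, ?_, ?_⟩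
  · refine ⟨?_, ?_, ?_, hδ, hKδ, by positivity, ?_, ?_, by positivity, ?_, ?_, ?_, hL, ?_, ?_,
      hc0, res_bound r a c hc0 hc⟩
    · exact ((qE_contDiff r).continuous.const_mul _ ).add hψs.continuous
    · exact ((WE r).continuous.const_smul (2 * a)).add (gradient_cont ψ hψs)
    · intro y
      simp only [hψ]
      rcases le_or_gt (qE r y) s1 with h | h
      · rw [hρ1 _ h]; have := hHm 0 rfl y; linarith
      · rw [hH0 y (by linarith)]
        have := hρ0 (qE r y)
        have := mul_nonneg ha.le (qE_nonneg r y)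
        linarith
    · intro y
      rcases lt_or_ge ‖y‖ δ with h | h
      · rw [hKδ y h]; positivity
      · have h1 := mul_le_mul_of_nonneg_left (qE_le r y) ha.le
        have h2 := le_of_abs_le (hP' y)
        have h3 : P ≤ P / δ ^ 2 * ‖y‖ ^ 2 := by
          rw [div_mul_eq_mul_div, le_div_iff₀ (by positivity)]
          gcongr
        nlinarith
    · intro y
      rw [hWi]
      have h2 := neg_le_of_abs_le (hP' y)
      linarith
    · intro y
      rw [hWi]
      have := mul_le_mul_of_nonneg_left (hwq y) ha.le
      linarith
    · simp
    · rw [hWi]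
      have h1 : qE r (EuclideanSpace.single i0 1) = 1 / r i0 ^ 2 := by
        rw [qE, Finset.sum_eq_single i0]
        · simp
        · intro b _ hb; simp [hb]
        · simp
      have := hr i0
      rw [h1, mul_one_div, lt_div_iff₀ (by positivity)]
      exact hai
    · intro y v
      rw [qE_add, inner_add_left, real_inner_smul_left]
      have := hsec y v
      have := mul_nonneg ha.le (qE_nonneg r v)
      nlinarith
    · intro y
      rw [hWe, add_sub_cancel_left]
      exact hB y
  · intro y; simp only [hψ]; ring
  · intro y
    simp only [hψg]
    rw [mul_add, add_smul]; abel

theorem upper_bound (r : Fin n → ℝ) (hr : ∀ i, 0 < r i) (i0 : Fin n) (H : Esp n → ℝ)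
    (hH : InHclass {z : Esp n | qE r z < 1} {0} H) (hfast : ¬ HasFastOrbit H) :
    H 0 ≤ Real.pi * r i0 ^ 2 := by
  by_contra hcon
  push Not at hcon
  apply hfast
  obtain ⟨a, ha1, ha2, ha3⟩ := choose_a r _ _ hcon
  have ha : 0 < a := lt_of_le_of_lt (by have := Real.pi_pos; positivity) ha1
  obtain ⟨ρ, s1, s2, hs1, hρ, hρ1, hρ0, hρa, hρ2⟩ := rho_exists (H 0) a ha ha2
  obtain ⟨K, U, W, e0, C, δ, A, B, L, c, w0, hG, hK, hU⟩ :=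
    upper_ghyp r hr i0 H hH a ha ha1 ha3 ρ s1 s2 hs1 hρ hρ1 hρ0 hρ2
  obtain ⟨X, hX, hXd, hXi⟩ := g_main hG
  obtain ⟨hHs, hHc, hHt, -, hHm⟩ := hH
  have hHout : ∀ y, 1 ≤ qE r y → H y = 0 ∧ gradient H y = 0 := by
    intro y hy
    have hy' : y ∉ tsupport H := fun h => absurd (hHt h) (not_lt.2 hy)
    refine ⟨image_eq_zero_of_notMem_tsupport hy', ?_⟩
    have h1 : H =ᶠ[𝓝 y] fun _ => 0 := notMem_tsupport_iff_eventuallyEq.1 hy'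
    rw [h1.gradient_eq]
    exact gradient_fun_const y (0 : ℝ)
  have hp : ∀ t : ℝ, HasDerivAt (fun t : ℝ => qE r (X t))
      (2 * ⟪WE r (X t), Complex.I • U (X t)⟫) t := fun t => qE_curve r (hXd t)
  have hp0 : ∀ t : ℝ, 1 ≤ qE r (X t) → 2 * ⟪WE r (X t), Complex.I • U (X t)⟫ = 0 := by
    intro t ht
    rw [hU, (hHout _ ht).2, sub_zero, smul_comm, real_inner_smul_right, inner_I_smul_self]
    ring
  have hF : ∀ t : ℝ, HasDerivAt (fun t : ℝ => expNegInvGlue (qE r (X t) - 1)) 0 t := by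
    intro t
    rcases le_or_gt 1 (qE r (X t)) with ht | ht
    · have h1 := (hp t).sub_const 1
      rw [hp0 t ht] at h1
      have h2 : HasDerivAt expNegInvGlue (deriv expNegInvGlue (qE r (X t) - 1))
          (qE r (X t) - 1) :=
        ((expNegInvGlue.contDiff (n := 1)).differentiable (by simp) _).hasDerivAt
      simpa [Function.comp_def] using h2.comp t h1
    · have h1 : ∀ᶠ s : ℝ in 𝓝 t, qE r (X s) < 1 :=
        (hp t).continuousAt.eventually_lt continuousAt_const ht
      refine (hasDerivAt_const t (0 : ℝ)).congr_of_eventuallyEq ?_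
      filter_upwards [h1] with s hs
      exact expNegInvGlue.zero_of_nonpos (by linarith)
  have hFc : ∀ s t : ℝ, expNegInvGlue (qE r (X s) - 1) = expNegInvGlue (qE r (X t) - 1) :=
    is_const_of_deriv_eq_zero (fun t => (hF t).differentiableAt) (fun t => (hF t).deriv)
  have hneg : ∀ P : UnitAddCircle → ℝ, (∀ t : ℝ, P t ≤ 0) → ¬ 0 < ∫ t, P t ∂haarAddCircle := by
    intro P hP
    refine not_lt.2 (integral_nonpos fun t => ?_)
    obtain ⟨s, rfl⟩ := QuotientAddGroup.mk_surjective t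
    exact hP s
  have hle : ∀ t : ℝ, qE r (X t) ≤ 1 := by
    by_contra hc
    push Not at hc
    obtain ⟨t0, ht0⟩ := hc
    have hall : ∀ t : ℝ, 1 < qE r (X t) := by
      intro t
      by_contra h
      have h1 := hFc t t0
      rw [expNegInvGlue.zero_of_nonpos (by linarith)] at h1
      have := expNegInvGlue.pos_of_pos (x := qE r (X t0) - 1) (by linarith)
      linarith
    refine hneg _ (fun t => ?_) hXi
    rw [hU, hK, (hHout _ (hall t).le).1, (hHout _ (hall t).le).2, sub_zero, sub_zero,
      real_inner_smul_left, WE_inner_self]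
    have h1 : deriv ρ (qE r (X t)) ≤ 0 := hρa.deriv_nonpos
    have h2 := hρ0 (qE r (X t))
    have h3 := mul_nonpos_of_nonpos_of_nonneg h1 (qE_nonneg r (X t))
    linarith
  have hUH : ∀ t : ℝ, U (X t) = - gradient H (X t) := by
    intro t
    have h1 : ρ =ᶠ[𝓝 (qE r (X t))] fun s => H 0 - a * s := by
      filter_upwards [Iio_mem_nhds ((hle t).trans_lt hs1)] with s hs
      exact hρ1 s (le_of_lt hs)
    have h2 : HasDerivAt (fun s => H 0 - a * s) (-a) (qE r (X t)) := by
      simpa using ((hasDerivAt_id (qE r (X t))).const_mul a).const_sub (H 0)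
    rw [hU, h1.deriv_eq, h2.deriv]; simp
  refine ⟨fun t => X ((-t : ℝ) : UnitAddCircle), 1, ⟨one_pos, fun t => ?_, fun t => ?_, ?_⟩, le_rfl⟩
  · have h1 := (hXd (-t)).scomp t (hasDerivAt_neg t)
    rw [hUH] at h1
    simpa [hamVF, Function.comp_def] using h1
  · have h1 := AddCircle.coe_add_period (1 : ℝ) (-(t + 1))
    have h2 : -(t + 1) + 1 = -t := by ring
    rw [h2] at h1
    exact congrArg X h1.symm
  · by_contra hc
    push Not at hc
    have hconst : ∀ t : ℝ, X t = X (0 : ℝ) := fun t => by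
      have := hc (-t) 0
      simpa using this
    refine hneg _ (fun t => ?_) hXi
    have h1 : HasDerivAt (fun t : ℝ => X t) 0 t := by
      have : (fun t : ℝ => X t) = fun _ => X (0 : ℝ) := funext hconst
      rw [this]; exact hasDerivAt_const _ _
    have h2 := (hXd t).unique h1
    have h3 : U (X t) = 0 := (smul_eq_zero.1 h2).resolve_left Complex.I_ne_zero
    rw [h3, inner_zero_left]
    have := hG.K0 (X t)
    linarith

end Upper

/-! Part 10 -/

section Lower
open MeasureTheory

theorem profile_exists (a κ : ℝ) (ha : 0 < a) (haκ : a < κ) :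
    ∃ (f : ℝ → ℝ) (ε : ℝ), 0 < ε ∧ ContDiff ℝ (⊤ : ℕ∞) f ∧ (∀ s ≤ ε, f s = a) ∧
      (∀ s ≥ 1 - ε, f s = 0) ∧ (∀ s, |deriv f s| < κ) ∧ Antitone f := by
  have hκ : 0 < κ := ha.trans haκ
  set ε := (1 - a / κ) / 8 with hε
  have h1 : a / κ < 1 := (div_lt_one hκ).2 haκ
  have h1' : 0 < a / κ := by positivity
  have hε0 : 0 < ε := by rw [hε]; linarith
  have hε1 : ε < 1 / 8 := by rw [hε]; linarith
  let g : ContDiffBump (1 / 2 : ℝ) := ⟨1 / 2 - 2 * ε, 1 / 2 - ε, by linarith, by linarith⟩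
  set φ : ℝ → ℝ := g.normed volume with hφ
  have hφc : Continuous φ := g.continuous_normed
  have hφs : ContDiff ℝ (⊤ : ℕ∞) φ := g.contDiff_normed
  have hφ0 : ∀ x, 0 ≤ φ x := g.nonneg_normed
  have hφ1 : ∀ x, φ x ≤ 1 / (1 - 4 * ε) := by
    intro x
    have := g.normed_le_div_measure_closedBall_rIn (μ := volume) x
    rw [Real.volume_real_closedBall (by exact g.rIn_pos.le)] at this
    refine this.trans_eq ?_
    congr 1
    change 2 * (1 / 2 - 2 * ε) = _
    ring
  have hsupp : Function.support φ = Ioo ε (1 - ε) := by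
    rw [hφ, g.support_normed_eq, Real.ball_eq_Ioo]
    congr 1
    · change 1 / 2 - (1 / 2 - ε) = ε; ring
    · change 1 / 2 + (1 / 2 - ε) = 1 - ε; ring
  have hder : ∀ s, HasDerivAt (fun s => a * (1 - ∫ x in (0 : ℝ)..s, φ x)) (-(a * φ s)) s := by
    intro s
    have h2 : HasDerivAt (fun s => ∫ x in (0 : ℝ)..s, φ x) (φ s) s :=
      (hφc.integral_hasStrictDerivAt 0 s).hasDerivAt
    simpa using (h2.const_sub 1).const_mul a
  have hder' : deriv (fun s => a * (1 - ∫ x in (0 : ℝ)..s, φ x)) = fun s => -(a * φ s) :=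
    funext fun s => (hder s).deriv
  refine ⟨fun s => a * (1 - ∫ x in (0 : ℝ)..s, φ x), ε, hε0, ?_, ?_, ?_, ?_, ?_⟩
  · refine contDiff_infty_iff_deriv.2 ⟨fun s => (hder s).differentiableAt, ?_⟩
    rw [hder']
    exact (contDiff_const.mul hφs).neg
  · intro s hs
    have : ∫ x in (0 : ℝ)..s, φ x = 0 := by
      refine intervalIntegral.integral_zero_ae (Filter.Eventually.of_forall fun x hx => ?_)
      by_contra hne
      have h3 : x ∈ Function.support φ := hne
      rw [hsupp] at h3
      have h4 : x ≤ max 0 s := hx.2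
      have h5 : max 0 s ≤ ε := max_le hε0.le hs
      linarith [h3.1]
    dsimp only
    rw [this]; ring
  · intro s hs
    have : ∫ x in (0 : ℝ)..s, φ x = 1 := by
      rw [intervalIntegral.integral_eq_integral_of_support_subset, hφ]
      · exact g.integral_normed
      · rw [hsupp]
        intro x hx
        exact ⟨hε0.trans hx.1, hx.2.le.trans hs⟩
    dsimp only
    rw [this]; ring
  · intro s
    rw [hder']
    dsimp only
    rw [abs_neg, abs_of_nonneg (mul_nonneg ha.le (hφ0 s))]
    refine lt_of_le_of_lt (mul_le_mul_of_nonneg_left (hφ1 s) ha.le) ?_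
    rw [mul_one_div, div_lt_iff₀ (by linarith)]
    have : κ * (1 - 4 * ε) = κ / 2 + a / 2 := by
      rw [hε]; field_simp; ring
    rw [this]; linarith
  · refine antitone_of_deriv_nonpos (fun s => (hder s).differentiableAt) fun s => ?_
    rw [hder']
    have := mul_nonneg ha.le (hφ0 s)
    dsimp only
    linarith

theorem scalar_rot (u : ℝ → ℂ) (l T : ℝ) (hT : 0 < T) (hT1 : T ≤ 1) (hl : |l| < 2 * Real.pi)
    (hu : ∀ t, HasDerivAt u (Complex.I * l * u t) t) (hper : u T = u 0) (t : ℝ) : u t = u 0 := by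
  have hE : ∀ t : ℝ, HasDerivAt (fun t : ℝ => Complex.exp (-(Complex.I * l) * t))
      (Complex.exp (-(Complex.I * l) * t) * (-(Complex.I * l))) t := by
    intro t
    have h1 : HasDerivAt (fun t : ℝ => -(Complex.I * l) * (t : ℂ)) (-(Complex.I * l)) t := by
      simpa using (Complex.ofRealCLM.hasDerivAt (x := t)).const_mul (-(Complex.I * l))
    exact h1.cexp
  have hF : ∀ t : ℝ, HasDerivAt (fun t : ℝ => Complex.exp (-(Complex.I * l) * t) * u t) 0 t := by
    intro t
    refine ((hE t).mul (hu t)).congr_deriv ?_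
    ring
  have hc : ∀ t : ℝ, Complex.exp (-(Complex.I * l) * t) * u t = u 0 := by
    intro t
    have := is_const_of_deriv_eq_zero (fun t => (hF t).differentiableAt)
      (fun t => (hF t).deriv) t 0
    simpa using this
  by_cases h0 : u 0 = 0
  · have := hc t
    rw [h0, mul_eq_zero] at this
    rw [h0]
    exact this.resolve_left (Complex.exp_ne_zero _)
  · have h1 := hc T
    rw [hper] at h1
    have h2 : Complex.exp (-(Complex.I * l) * T) = 1 := mul_right_cancel₀ h0 (by rw [h1, one_mul])
    obtain ⟨k, hk⟩ := Complex.exp_eq_one_iff.1 h2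
    have h3 : -(l * T) = k * (2 * Real.pi) := by
      have h4 : Complex.I * ((-(l * T) : ℝ) : ℂ) = Complex.I * ((k * (2 * Real.pi) : ℝ) : ℂ) := by
        push_cast; linear_combination hk
      exact_mod_cast mul_left_cancel₀ Complex.I_ne_zero h4
    have h5 : |l * T| < 2 * Real.pi := by
      rw [abs_mul, abs_of_pos hT]
      nlinarith [abs_nonneg l]
    have hpi := Real.pi_pos
    have hk0 : k = 0 := by
      rw [← abs_neg, h3, abs_mul, abs_of_pos (by positivity : 0 < 2 * Real.pi)] at h5
      have h6 : |(k : ℝ)| < 1 := by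
        by_contra h; push Not at h; nlinarith
      have h7 : |k| < 1 := by exact_mod_cast h6
      exact Int.abs_lt_one_iff.1 h7
    rw [hk0] at h3
    have hl0 : l = 0 := by
      have : l * T = 0 := by simpa using h3
      exact (mul_eq_zero.1 this).resolve_right hT.ne'
    have := hc t
    simpa [hl0] using this

theorem lower_bound (r : Fin n → ℝ) (hr : ∀ i, 0 < r i) (i0 : Fin n) (hmin : ∀ i, r i0 ≤ r i)
    (a : ℝ) (ha : 0 < a) (ha' : a < Real.pi * r i0 ^ 2) :
    ∃ H : Esp n → ℝ, InHclass {z : Esp n | qE r z < 1} {0} H ∧ ¬ HasFastOrbit H ∧ H 0 = a := by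
  obtain ⟨f, ε, hε, hf, hf1, hf2, hf3, hfa⟩ := profile_exists a _ ha ha'
  have hq := (qE_contDiff r)
  have hH0 : f (qE r (0 : Esp n)) = a := by rw [qE_zero]; exact hf1 0 hε.le
  have hts : tsupport (fun z : Esp n => f (qE r z)) ⊆ {y | qE r y ≤ 1 - ε} := by
    refine closure_minimal (fun y hy => ?_) (isClosed_le hq.continuous continuous_const)
    by_contra h
    exact hy (hf2 _ (not_le.1 h).le)
  refine ⟨fun z => f (qE r z), ⟨hf.comp hq, ?_, ?_, ?_, ?_⟩, ?_, hH0⟩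
  · exact (qE_compact r hr _).of_isClosed_subset (isClosed_tsupport _) hts
  · intro y hy
    have h1 : qE r y ≤ 1 - ε := hts hy
    change qE r y < 1
    linarith
  · refine ⟨{y | qE r y < ε}, isOpen_lt hq.continuous continuous_const, ?_, a, fun x hx =>
      hf1 _ (le_of_lt hx)⟩
    rintro _ rfl
    change qE r 0 < ε
    rw [qE_zero]; exact hε
  · rintro _ rfl x
    exact hfa (by rw [qE_zero]; exact qE_nonneg r x)
  · rintro ⟨γ, T, ⟨hT, hd, hper, t0, t1, hne⟩, hT1⟩
    have hgrad : ∀ y, gradient (fun z : Esp n => f (qE r z)) y =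
        (2 * deriv f (qE r y)) • WE r y := fun y =>
      (qE_comp_hasGradientAt r y (hf.differentiable (by simp) _).hasDerivAt).gradient
    have hd' : ∀ t, HasDerivAt γ (Complex.I • (2 * deriv f (qE r (γ t))) • WE r (γ t)) t := by
      intro t
      have := hd t
      rwa [hamVF, hgrad] at this
    have hqc : ∀ t, HasDerivAt (fun t => qE r (γ t)) 0 t := by
      intro t
      have := qE_curve r (hd' t)
      rwa [smul_comm, real_inner_smul_right, inner_I_smul_self, mul_zero, mul_zero] at this
    have hqc' : ∀ t, qE r (γ t) = qE r (γ 0) := fun t =>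
      is_const_of_deriv_eq_zero (fun t => (hqc t).differentiableAt) (fun t => (hqc t).deriv) t 0
    have hconst : ∀ t, γ t = γ 0 := by
      intro t
      ext i
      have hri := hr i
      refine scalar_rot (fun t => γ t i) (2 * deriv f (qE r (γ 0)) / r i ^ 2) T hT hT1 ?_ ?_ ?_ t
      · rw [abs_div, abs_mul, abs_of_pos (by positivity : 0 < r i ^ 2), abs_two,
          div_lt_iff₀ (by positivity)]
        have h1 := hf3 (qE r (γ 0))
        have h2 : r i0 ^ 2 ≤ r i ^ 2 := by
          have := hmin i
          have := (hr i0).le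
          gcongr
        have h3 := mul_le_mul_of_nonneg_left h2 Real.pi_pos.le
        linarith
      · intro t
        refine (esp_hasDerivAt_apply (hd' t) i).congr_deriv ?_
        rw [hqc' t]
        simp only [PiLp.smul_apply, WE_apply, smul_eq_mul, Complex.real_smul]
        push_cast; ring
      · have := hper 0
        rw [zero_add] at this
        exact congrArg (fun v : Esp n => v i) this
    exact hne ((hconst t0).trans (hconst t1).symm)

end Lower


theorem stmt_9 (n : ℕ) (hn : 0 < n) (r : Fin n → ℝ)
    (hrpos : ∀ i, 0 < r i) (hrmono : Monotone r) :
    relCap {z : Esp n | ∑ i, ‖z i‖ ^ 2 / (r i) ^ 2 < 1} {(0 : Esp n)} =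
      ENNReal.ofReal (Real.pi * (r ⟨0, hn⟩) ^ 2) := by
  change relCap {z : Esp n | qE r z < 1} {(0 : Esp n)} = _
  have hκ : 0 < Real.pi * (r ⟨0, hn⟩) ^ 2 := by
    have := hrpos ⟨0, hn⟩
    have := Real.pi_pos
    positivity
  apply le_antisymm
  · refine sSup_le ?_
    rintro c ⟨H, hH, hfast, z, hz, rfl⟩
    have hz0 : z = 0 := hz
    rw [hz0]
    exact ENNReal.ofReal_le_ofReal (upper_bound r hrpos ⟨0, hn⟩ H hH hfast)
  · refine le_of_forall_lt fun c hc => ?_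
    have hc1 : c ≠ ⊤ := ne_top_of_lt hc
    have hc2 : c.toReal < Real.pi * (r ⟨0, hn⟩) ^ 2 := by
      rwa [ENNReal.lt_ofReal_iff_toReal_lt hc1] at hc
    have hc0 : 0 ≤ c.toReal := ENNReal.toReal_nonneg
    obtain ⟨a, ha1, ha2⟩ := exists_between hc2
    obtain ⟨H, hH, hfast, hHa⟩ := lower_bound r hrpos ⟨0, hn⟩
      (fun i => hrmono (Fin.mk_le_of_le_val (Nat.zero_le _))) a (lt_of_le_of_lt hc0 ha1) ha2
    have h1 : c < ENNReal.ofReal a := (ENNReal.lt_ofReal_iff_toReal_lt hc1).2 ha1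
    refine h1.trans_le (le_sSup ⟨H, hH, hfast, 0, rfl, ?_⟩)
    rw [hHa]
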